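/- arXiv:2002.12722 — 2 statements merged into one kernel-verified Lean document; each statement's English description precedes it below -/
import Mathlib

section
/- For every j ∈ L and every x ∈ 𝒳_1: E_x[Ñ_j] ≤ ( a^{4^{l−1}} / Σ_{ℓ∈L∖{1}} p_{1ℓ} ) · ( Σ_{g∈G(j)} π(g) / Σ_{g∈G(1)} π(g) ). -/
open MeasureTheory ProbabilityTheory
open scoped ENNReal Classical

namespace FW

/-- `g` represents a `W`-graph on `Fin l`: the arrows are `i → g i` for `i ∉ W`
(we normalize `g i = i` on `W`). -/
def IsWGraph {l : ℕ} (W : Finset (Fin l)) (g : Fin l → Fin l) : Prop :=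
  (∀ i ∈ W, g i = i) ∧ ∀ i ∉ W, g i ≠ i ∧ ∃ n : ℕ, g^[n] i ∈ W

/-- `Σ_{g ∈ G(W)} π(g)` where `π(g) = ∏_{(i→j) ∈ g} p_{ij}`. -/
noncomputable def graphSum {l : ℕ} (p : Fin l → Fin l → ℝ≥0∞) (W : Finset (Fin l)) : ℝ≥0∞ :=
  ∑ g ∈ Finset.univ.filter (IsWGraph W), ∏ i ∈ Wᶜ, p i (g i)

/-- `n`-step transition probabilities. -/
noncomputable def matPow {l : ℕ} (p : Fin l → Fin l → ℝ≥0∞) : ℕ → Fin l → Fin l → ℝ≥0∞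
  | 0 => fun i j => if i = j then 1 else 0
  | n + 1 => fun i j => ∑ k, matPow p n i k * p k j

/-- Irreducibility of the transition matrix `p`. -/
def Irreducible {l : ℕ} (p : Fin l → Fin l → ℝ≥0∞) : Prop :=
  ∀ i j : Fin l, ∃ n : ℕ, 0 < matPow p n i j

variable {X : Type} [MeasurableSpace X]

/-- The probability, for the chain with transition kernel `κ` currently at `x`, that the next
`k` steps successively lie in the sets of the list `As`. -/
noncomputable def cylProb (κ : Kernel X X) : X → List (Set X) → ℝ≥0∞
  | _, [] => 1
  | x, A :: As => ∫⁻ y in A, cylProb κ y As ∂ κ x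

/-- `Q` is the family of path laws of the Markov chain on `X` with transition kernel `κ`. -/
def IsMarkovChainLawKernel (κ : Kernel X X) (Q : X → Measure (ℕ → X)) : Prop :=
  (∀ x, IsProbabilityMeasure (Q x)) ∧
    ∀ (x : X) (n : ℕ) (A : ℕ → Set X), (∀ k, MeasurableSet (A k)) →
      Q x {ω | ∀ k ≤ n, ω k ∈ A k} =
        Set.indicator (A 0) (fun _ => 1) x *
          cylProb κ x ((List.range n).map fun k => A (k + 1))

/-- First hitting time `T̃_B = inf {n ≥ 0 : ω n ∈ B}` for the chain on `X`. -/
noncomputable def hitS (B : Set X) (ω : ℕ → X) : ℝ≥0∞ :=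
  ⨅ n ∈ {n : ℕ | ω n ∈ B}, (n : ℝ≥0∞)

/-- `Ñ = inf {n ≥ Ň : ω n ∈ 𝒳_o}` where `Ň = inf {n ≥ 0 : ω n ∈ ⋃_{j ≠ o} 𝒳_j}`. -/
noncomputable def retMS {l : ℕ} (Xs : Fin l → Set X) (o : Fin l) (ω : ℕ → X) : ℝ≥0∞ :=
  ⨅ n ∈ {n : ℕ | hitS (⋃ (j) (_ : j ≠ o), Xs j) ω ≤ (n : ℝ≥0∞) ∧ ω n ∈ Xs o}, (n : ℝ≥0∞)

/-- `Ñ_j = |{n ≥ 0 : n < Ñ and ω n ∈ 𝒳_j}|`, the number of visits (including time 0)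
to `𝒳_j` before `Ñ`. -/
noncomputable def numVisitsM {l : ℕ} (Xs : Fin l → Set X) (o j : Fin l) (ω : ℕ → X) : ℝ≥0∞ :=
  ∑' n : ℕ, if (n : ℝ≥0∞) < retMS Xs o ω ∧ ω n ∈ Xs j then 1 else 0

/-! ### Combinatorics: the Markov chain tree theorem -/

theorem reach_congr {l : ℕ} {g h : Fin l → Fin l} {i : Fin l} (hgh : ∀ x, x ≠ i → g x = h x)
    (n : ℕ) : ∀ k, g^[n] k = i → ∃ n, h^[n] k = i := by
  induction n with
  | zero => intro k hk; exact ⟨0, hk⟩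
  | succ n ih =>
    intro k hk
    by_cases hki : k = i
    · exact ⟨0, hki⟩
    · rw [Function.iterate_succ_apply, hgh k hki] at hk
      obtain ⟨m, hm⟩ := ih _ hk
      exact ⟨m + 1, by rw [Function.iterate_succ_apply]; exact hm⟩

theorem isWGraph_single {l : ℕ} {j : Fin l} {g : Fin l → Fin l} :
    IsWGraph {j} g ↔ g j = j ∧ (∀ i, i ≠ j → g i ≠ i) ∧ ∀ i, ∃ n : ℕ, g^[n] i = j := by
  unfold IsWGraph
  simp only [Finset.mem_singleton, forall_eq]
  constructor
  · rintro ⟨h1, h2⟩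
    refine ⟨h1, fun i hi => (h2 i hi).1, fun i => ?_⟩
    by_cases hi : i = j
    · exact ⟨0, hi⟩
    · exact (h2 i hi).2
  · rintro ⟨h1, h2, h3⟩
    exact ⟨h1, fun i hi => ⟨h2 i hi, h3 i⟩⟩

/-- Fixed-point-free functional graphs all of whose points lead to `j`. -/
noncomputable def uni {l : ℕ} (j : Fin l) : Finset (Fin l → Fin l) :=
  Finset.univ.filter fun h => (∀ i, h i ≠ i) ∧ ∀ i, ∃ n : ℕ, h^[n] i = j

theorem prod_update {l : ℕ} (q : Fin l → Fin l → ℝ≥0∞) (g : Fin l → Fin l) (i k : Fin l) :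
    ∏ x, q x (Function.update g i k x) = q i k * ∏ x ∈ ({i}ᶜ : Finset (Fin l)), q x (g x) := by
  rw [← Finset.prod_mul_prod_compl {i}, Finset.prod_singleton, Function.update_self]
  congr 1
  apply Finset.prod_congr rfl
  intro x hx
  rw [Function.update_of_ne (by simpa using hx)]

theorem update_mem_uni {l : ℕ} {i j k : Fin l} {g : Fin l → Fin l} (hg : IsWGraph {i} g)
    (hk : k ≠ i) (hj : j = i ∨ j = k) : Function.update g i k ∈ uni j := by
  rw [isWGraph_single] at hg
  obtain ⟨h1, h2, h3⟩ := hg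
  have hr : ∀ x, ∃ n : ℕ, (Function.update g i k)^[n] x = i := fun x => by
    obtain ⟨n, hn⟩ := h3 x
    exact reach_congr (fun y hy => (Function.update_of_ne hy _ _).symm) n x hn
  simp only [uni, Finset.mem_filter, Finset.mem_univ, true_and]
  refine ⟨fun x => ?_, fun x => ?_⟩
  · by_cases hx : x = i
    · subst hx; simpa using hk
    · rw [Function.update_of_ne hx]; exact h2 x hx
  · obtain ⟨n, hn⟩ := hr x
    rcases hj with rfl | rfl
    · exact ⟨n, hn⟩
    · exact ⟨n + 1, by rw [Function.iterate_succ_apply', hn]; simp⟩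

theorem isWGraph_update {l : ℕ} {i : Fin l} {h : Fin l → Fin l} (h1 : ∀ i, h i ≠ i)
    (h2 : ∀ x, ∃ n : ℕ, h^[n] x = i) : IsWGraph {i} (Function.update h i i) := by
  rw [isWGraph_single]
  refine ⟨by simp, fun x hx => ?_, fun x => ?_⟩
  · rw [Function.update_of_ne hx]; exact h1 x
  · obtain ⟨n, hn⟩ := h2 x
    exact reach_congr (fun y hy => (Function.update_of_ne hy _ _).symm) n x hn

theorem tree_out {l : ℕ} (q : Fin l → Fin l → ℝ≥0∞) (j : Fin l) :
    (∑ k ∈ ({j}ᶜ : Finset (Fin l)), q j k) * graphSum q {j} = ∑ h ∈ uni j, ∏ x, q x (h x) := by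
  unfold graphSum
  rw [Finset.sum_mul_sum, ← Finset.sum_product']
  refine Finset.sum_bij' (fun z _ => Function.update z.2 j z.1)
    (fun h _ => (h j, Function.update h j j)) ?_ ?_ ?_ ?_ ?_
  · rintro ⟨k, g⟩ hz
    simp only [Finset.mem_product, Finset.mem_compl, Finset.mem_singleton, Finset.mem_filter,
      Finset.mem_univ, true_and] at hz
    exact update_mem_uni hz.2 hz.1 (Or.inl rfl)
  · intro h hh
    simp only [uni, Finset.mem_filter, Finset.mem_univ, true_and] at hh
    simp only [Finset.mem_product, Finset.mem_compl, Finset.mem_singleton, Finset.mem_filter,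
      Finset.mem_univ, true_and]
    exact ⟨hh.1 j, isWGraph_update hh.1 hh.2⟩
  · rintro ⟨k, g⟩ hz
    simp only [Finset.mem_product, Finset.mem_compl, Finset.mem_singleton, Finset.mem_filter,
      Finset.mem_univ, true_and] at hz
    have := (isWGraph_single.1 hz.2).1
    simp only [Function.update_self, Function.update_idem, Prod.mk.injEq, true_and]
    exact Function.update_eq_self_iff.2 this.symm
  · intro h hh
    simp
  · rintro ⟨k, g⟩ hz
    exact (prod_update q g j k).symm

theorem pred_unique {l : ℕ} {h : Fin l → Fin l} {i i' j : Fin l} (hi : h i = j) (hi' : h i' = j)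
    (hr : ∃ n : ℕ, h^[n] j = i) (hr' : ∃ n : ℕ, h^[n] j = i') : i = i' := by
  obtain ⟨a, ha⟩ := hr
  obtain ⟨b, hb⟩ := hr'
  have pa : Function.IsPeriodicPt h (a + 1) j := by
    show h^[a+1] j = j
    rw [Function.iterate_succ_apply', ha, hi]
  have pb : Function.IsPeriodicPt h (b + 1) j := by
    show h^[b+1] j = j
    rw [Function.iterate_succ_apply', hb, hi']
  have e1 : h^[a + (a + 1) * b] j = i := by
    rw [Function.iterate_add_apply, (pa.mul_const b).eq, ha]
  have e2 : h^[b + (b + 1) * a] j = i' := by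
    rw [Function.iterate_add_apply, (pb.mul_const a).eq, hb]
  have e3 : a + (a + 1) * b = b + (b + 1) * a := by ring
  rw [← e1, ← e2, e3]

theorem tree_in {l : ℕ} (q : Fin l → Fin l → ℝ≥0∞) (j : Fin l) :
    ∑ i ∈ ({j}ᶜ : Finset (Fin l)), graphSum q {i} * q i j = ∑ h ∈ uni j, ∏ x, q x (h x) := by
  unfold graphSum
  simp only [Finset.sum_mul]
  rw [Finset.sum_sigma']
  refine Finset.sum_bij (fun z _ => Function.update z.2 z.1 j) ?_ ?_ ?_ ?_
  · rintro ⟨i, g⟩ hz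
    simp only [Finset.mem_sigma, Finset.mem_compl, Finset.mem_singleton, Finset.mem_filter,
      Finset.mem_univ, true_and] at hz
    exact update_mem_uni hz.2 (Ne.symm hz.1) (Or.inr rfl)
  · rintro ⟨i, g⟩ hz ⟨i', g'⟩ hz' heq
    simp only [Finset.mem_sigma, Finset.mem_compl, Finset.mem_singleton, Finset.mem_filter,
      Finset.mem_univ, true_and] at hz hz'
    simp only at heq
    have m1 := update_mem_uni hz.2 (Ne.symm hz.1) (Or.inl rfl)
    have m2 := update_mem_uni hz'.2 (Ne.symm hz'.1) (Or.inl rfl)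
    simp only [uni, Finset.mem_filter, Finset.mem_univ, true_and] at m1 m2
    have hii : i = i' := by
      refine pred_unique (h := Function.update g i j) (j := j) (by simp) (by rw [heq]; simp)
        (m1.2 j) ?_
      rw [heq]; exact m2.2 j
    subst hii
    have hgg : g = g' := by
      funext x
      by_cases hx : x = i
      · subst hx
        rw [(isWGraph_single.1 hz.2).1, (isWGraph_single.1 hz'.2).1]
      · have := congrFun heq x
        rwa [Function.update_of_ne hx, Function.update_of_ne hx] at this
    subst hgg
    rfl
  · intro h hh
    simp only [uni, Finset.mem_filter, Finset.mem_univ, true_and] at hh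
    obtain ⟨n, hn⟩ := hh.2 (h j)
    have hi : h (h^[n] j) = j := by
      rw [← Function.iterate_succ_apply' h n j, Function.iterate_succ_apply, hn]
    refine ⟨⟨h^[n] j, Function.update h (h^[n] j) (h^[n] j)⟩, ?_, ?_⟩
    · simp only [Finset.mem_sigma, Finset.mem_compl, Finset.mem_singleton, Finset.mem_filter,
        Finset.mem_univ, true_and]
      refine ⟨fun e => hh.1 j (by rwa [e] at hi), isWGraph_update hh.1 fun x => ?_⟩
      obtain ⟨m, hm⟩ := hh.2 x
      exact ⟨n + m, by rw [Function.iterate_add_apply, hm]⟩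
    · simp only [Function.update_idem]
      funext x
      by_cases hx : x = h^[n] j
      · subst hx; rw [Function.update_self, hi]
      · rw [Function.update_of_ne hx]
  · rintro ⟨i, g⟩ hz
    rw [prod_update, mul_comm]

theorem tree_balance {l : ℕ} (q : Fin l → Fin l → ℝ≥0∞) (j : Fin l) :
    graphSum q {j} * (∑ k ∈ ({j}ᶜ : Finset (Fin l)), q j k) =
      ∑ i ∈ ({j}ᶜ : Finset (Fin l)), graphSum q {i} * q i j := by
  rw [tree_in, mul_comm, tree_out]

/-! ### Positivity of the graph sums -/

theorem matPow_pos_reach {l : ℕ} {p : Fin l → Fin l → ℝ≥0∞} {i : Fin l} (n : ℕ) :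
    ∀ j, 0 < matPow p n i j → Relation.ReflTransGen (fun x y => 0 < p x y) i j := by
  induction n with
  | zero =>
    intro j hj
    by_cases h : i = j
    · subst h; exact Relation.ReflTransGen.refl
    · simp [matPow, h] at hj
  | succ n ih =>
    intro j hj
    simp only [matPow] at hj
    obtain ⟨k, -, hk⟩ := Finset.exists_ne_zero_of_sum_ne_zero hj.ne'
    exact (ih k (pos_iff_ne_zero.2 (left_ne_zero_of_mul hk))).tail
      (pos_iff_ne_zero.2 (right_ne_zero_of_mul hk))

/-- `i` reaches `j` in `n` steps of positive probability. -/
def reachIn {l : ℕ} (p : Fin l → Fin l → ℝ≥0∞) (j : Fin l) : ℕ → Fin l → Prop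
  | 0, i => i = j
  | n + 1, i => ∃ k, 0 < p i k ∧ reachIn p j n k

theorem graphSum_pos {l : ℕ} {p : Fin l → Fin l → ℝ≥0∞} (hirr : Irreducible p) (j : Fin l) :
    0 < graphSum p {j} := by
  have hre : ∀ i, ∃ n, reachIn p j n i := by
    intro i
    obtain ⟨n, hn⟩ := hirr i j
    have := matPow_pos_reach n j hn
    clear hn
    induction this using Relation.ReflTransGen.head_induction_on with
    | refl => exact ⟨0, rfl⟩
    | head h _ ih =>
      obtain ⟨n, hn⟩ := ih
      exact ⟨n + 1, _, h, hn⟩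
  have hstep : ∀ i, ∃ k, i ≠ j → 0 < p i k ∧ Nat.find (hre k) < Nat.find (hre i) := by
    intro i
    by_cases hi : i = j
    · exact ⟨i, fun h => absurd hi h⟩
    · have hs := Nat.find_spec (hre i)
      cases hd : Nat.find (hre i) with
      | zero => rw [hd] at hs; exact absurd hs hi
      | succ n =>
        rw [hd] at hs
        obtain ⟨k, hk1, hk2⟩ := hs
        exact ⟨k, fun _ => ⟨hk1, Nat.lt_succ_of_le (Nat.find_min' (hre k) hk2)⟩⟩
  choose f hf using hstep
  have hG : IsWGraph {j} (Function.update f j j) := by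
    rw [isWGraph_single]
    refine ⟨by simp, fun i hi => ?_, ?_⟩
    · rw [Function.update_of_ne hi]
      intro e
      have := (hf i hi).2
      rw [e] at this
      exact lt_irrefl _ this
    · have : ∀ N i, Nat.find (hre i) ≤ N → ∃ n : ℕ, (Function.update f j j)^[n] i = j := by
        intro N
        induction N with
        | zero =>
          intro i hi
          have hs := Nat.find_spec (hre i)
          rw [Nat.le_zero.1 hi] at hs
          exact ⟨0, hs⟩
        | succ N ih =>
          intro i hi
          by_cases hij : i = j
          · exact ⟨0, hij⟩
          · obtain ⟨n, hn⟩ := ih (f i) (by have := (hf i hij).2; omega)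
            exact ⟨n + 1, by
              rw [Function.iterate_succ_apply, Function.update_of_ne hij]; exact hn⟩
      exact fun i => this _ i le_rfl
  unfold graphSum
  have hpos : 0 < ∏ i ∈ ({j}ᶜ : Finset (Fin l)), p i (Function.update f j j i) := by
    rw [pos_iff_ne_zero, Finset.prod_ne_zero_iff]
    intro i hi
    have hij : i ≠ j := by simpa using hi
    rw [Function.update_of_ne hij]
    exact (hf i hij).1.ne'
  refine lt_of_lt_of_le hpos ?_
  exact Finset.single_le_sum (f := fun g : Fin l → Fin l => ∏ i ∈ ({j}ᶜ : Finset (Fin l)), p i (g i))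
    (fun _ _ => zero_le) (Finset.mem_filter.2 ⟨Finset.mem_univ _, hG⟩)

theorem graphSum_le {l : ℕ} {p q : Fin l → Fin l → ℝ≥0∞} {a : ℝ≥0∞}
    (h : ∀ i j, j ≠ i → q i j ≤ a * p i j) (j : Fin l) :
    graphSum q {j} ≤ a ^ (l - 1) * graphSum p {j} := by
  unfold graphSum
  rw [Finset.mul_sum]
  refine Finset.sum_le_sum fun g hg => ?_
  have hg' : IsWGraph {j} g := by simpa using hg
  have hc : ({j}ᶜ : Finset (Fin l)).card = l - 1 := by
    rw [Finset.card_compl]; simp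
  rw [← hc, ← Finset.prod_const, ← Finset.prod_mul_distrib]
  refine Finset.prod_le_prod' fun i hi => h i (g i) ?_
  exact (isWGraph_single.1 hg').2.1 i (by simpa using hi)

theorem graphSum_ne_top {l : ℕ} {q : Fin l → Fin l → ℝ≥0∞}
    (h : ∀ i j, j ≠ i → q i j ≠ ⊤) (j : Fin l) : graphSum q {j} ≠ ⊤ := by
  unfold graphSum
  refine ENNReal.sum_ne_top.2 fun g hg => ENNReal.prod_ne_top fun i hi => h i (g i) ?_
  have hg' : IsWGraph {j} g := by simpa using hg
  exact (isWGraph_single.1 hg').2.1 i (by simpa using hi)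

/-! ### The maximum principle -/

theorem max_principle {l : ℕ} (q : Fin l → Fin l → ℝ) (u w : Fin l → ℝ) (o : Fin l)
    (hq : ∀ i j, j ≠ i → 0 ≤ q i j) (hw : ∀ i, 0 < w i)
    (hbal : ∀ j, w j * (∑ k ∈ ({j}ᶜ : Finset (Fin l)), q j k) =
      ∑ i ∈ ({j}ᶜ : Finset (Fin l)), w i * q i j)
    (hsub : ∀ j, j ≠ o → u j * (∑ k ∈ ({j}ᶜ : Finset (Fin l)), q j k) ≤
      ∑ i ∈ ({j}ᶜ : Finset (Fin l)), u i * q i j)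
    (hirr : ∀ j, Relation.ReflTransGen (fun x y => x ≠ y → 0 < q x y) o j) (j : Fin l) :
    u j * w o ≤ u o * w j := by
  have : Nonempty (Fin l) := ⟨o⟩
  obtain ⟨m, hm⟩ := Finite.exists_max (fun i => u i / w i)
  set c := u m / w m with hc
  have hs : ∀ i, 0 ≤ c * w i - u i := fun i => by
    have := (div_le_iff₀ (hw i)).1 (hm i)
    linarith
  have hstep : ∀ x y, c * w y - u y = 0 → y ≠ o → (x ≠ y → 0 < q x y) → c * w x - u x = 0 := by
    intro x y hy hyo hxy
    by_cases hne : x = y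
    · rw [hne]; exact hy
    have h1 := hsub y hyo
    have h2 := hbal y
    have h3 : ∑ i ∈ ({y}ᶜ : Finset (Fin l)), (c * w i - u i) * q i y ≤ 0 := by
      have : ∑ i ∈ ({y}ᶜ : Finset (Fin l)), (c * w i - u i) * q i y
          = c * ∑ i ∈ ({y}ᶜ : Finset (Fin l)), w i * q i y
            - ∑ i ∈ ({y}ᶜ : Finset (Fin l)), u i * q i y := by
        rw [Finset.mul_sum, ← Finset.sum_sub_distrib]
        exact Finset.sum_congr rfl fun i _ => by ring
      rw [this, ← h2]
      have hy' : u y = c * w y := by linarith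
      rw [hy'] at h1
      linarith
    have hnn : ∀ i ∈ ({y}ᶜ : Finset (Fin l)), 0 ≤ (c * w i - u i) * q i y := fun i hi =>
      mul_nonneg (hs i) (hq i y (by simpa [eq_comm] using hi))
    have h4 := (Finset.sum_eq_zero_iff_of_nonneg hnn).1
      (le_antisymm h3 (Finset.sum_nonneg hnn)) x (by simpa using hne)
    rcases mul_eq_zero.1 h4 with h | h
    · exact h
    · exact absurd h (hxy hne).ne'
  have hall : ∀ y, Relation.ReflTransGen (fun x y => x ≠ y → 0 < q x y) o y →
      c * w y - u y = 0 → c * w o - u o = 0 := by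
    intro y hy
    induction hy with
    | refl => exact id
    | tail h1 h2 ih =>
      rename_i b d
      intro hd
      by_cases hdo : d = o
      · rw [← hdo]; exact hd
      · exact ih (hstep _ _ hd hdo h2)
  have ho := hall m (hirr m) (by rw [hc, div_mul_cancel₀ _ (hw m).ne']; ring)
  have huo : u o = c * w o := by linarith
  rw [huo]
  have := mul_le_mul_of_nonneg_right (hs j) (hw o).le
  nlinarith [hs j, hw o]

/-- The linear-algebra core: occupation numbers `u` and flows `F` satisfying balance inequalities. -/
theorem flow_bound {l : ℕ} (hl : 2 ≤ l)
    (p : Fin l → Fin l → ℝ≥0∞) (hrow : ∀ i, ∑ j, p i j = 1) (hirr : Irreducible p)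
    (a : ℝ≥0∞) (ha1 : 1 ≤ a) (haT : a ≠ ⊤) (o : Fin l)
    (u : Fin l → ℝ≥0∞) (F : Fin l → Fin l → ℝ≥0∞) (hu : ∀ i, u i ≠ ⊤)
    (hF1 : ∀ i j, j ≠ i → a⁻¹ * p i j * u i ≤ F i j)
    (hF2 : ∀ i j, j ≠ i → F i j ≤ a * p i j * u i)
    (hsum : ∀ i, ∑ j, F i j = u i)
    (hbal : ∀ j, j ≠ o → u j ≤ ∑ i, F i j)
    (ho : u o ≤ 1 + F o o) (j : Fin l) :
    u j ≤ (a ^ (4 ^ (l - 1)) / ∑ m ∈ ({o}ᶜ : Finset (Fin l)), p o m) *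
          (graphSum p {j} / graphSum p {o}) := by
  have ha0 : a ≠ 0 := (lt_of_lt_of_le one_pos ha1).ne'
  have hp1 : ∀ i j, p i j ≠ ⊤ := fun i j => by
    have : p i j ≤ 1 := by
      rw [← hrow i]
      exact Finset.single_le_sum (f := p i) (fun _ _ => zero_le) (Finset.mem_univ j)
    exact ne_top_of_le_ne_top ENNReal.one_ne_top this
  have hFT : ∀ i j, F i j ≠ ⊤ := fun i j => by
    have : F i j ≤ u i := by
      rw [← hsum i]
      exact Finset.single_le_sum (f := F i) (fun _ _ => zero_le) (Finset.mem_univ j)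
    exact ne_top_of_le_ne_top (hu i) this
  have hsplit : ∀ (f : Fin l → ℝ≥0∞) (i : Fin l),
      ∑ k, f k = f i + ∑ k ∈ ({i}ᶜ : Finset (Fin l)), f k := fun f i => by
    rw [← Finset.sum_add_sum_compl {i}, Finset.sum_singleton]
  -- the bound on `u o`
  have huo : u o ≤ a / ∑ m ∈ ({o}ᶜ : Finset (Fin l)), p o m := by
    have h1 : ∑ k ∈ ({o}ᶜ : Finset (Fin l)), F o k ≤ 1 := by
      have := hsum o
      rw [hsplit] at this
      rw [← this, add_comm] at ho
      exact (ENNReal.add_le_add_iff_right (hFT o o)).1 ho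
    have h2 : a⁻¹ * (u o * ∑ m ∈ ({o}ᶜ : Finset (Fin l)), p o m) ≤ 1 := by
      refine le_trans ?_ h1
      rw [Finset.mul_sum, Finset.mul_sum]
      refine Finset.sum_le_sum fun k hk => ?_
      refine le_trans (le_of_eq ?_) (hF1 o k (by simpa using hk))
      ring
    have h3 : u o * ∑ m ∈ ({o}ᶜ : Finset (Fin l)), p o m ≤ a := by
      have := mul_le_mul_right h2 a
      rwa [← mul_assoc, ENNReal.mul_inv_cancel ha0 haT, one_mul, mul_one] at this
    refine (ENNReal.le_div_iff_mul_le (Or.inr ha0) (Or.inr haT)).2 h3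
  -- averaged transition probabilities
  set q : Fin l → Fin l → ℝ≥0∞ := fun i k => if u i = 0 then p i k else F i k / u i with hq
  have hqu : ∀ i k, k ≠ i → u i * q i k = F i k := by
    intro i k hk
    by_cases h : u i = 0
    · have := hF2 i k hk
      rw [h, mul_zero] at this
      rw [h, zero_mul]
      exact (le_antisymm this zero_le).symm
    · simp only [hq, h, if_false]
      exact ENNReal.mul_div_cancel h (hu i)
  have hqle : ∀ i k, k ≠ i → q i k ≤ a * p i k := by
    intro i k hk
    by_cases h : u i = 0
    · simp only [hq, h, if_true]
      exact le_mul_of_one_le_left zero_le ha1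
    · simp only [hq, h, if_false]
      exact ENNReal.div_le_of_le_mul (hF2 i k hk)
  have hqge : ∀ i k, k ≠ i → p i k ≤ a * q i k := by
    intro i k hk
    by_cases h : u i = 0
    · simp only [hq, h, if_true]
      exact le_mul_of_one_le_left zero_le ha1
    · simp only [hq, h, if_false]
      rw [← mul_div_assoc]
      refine (ENNReal.le_div_iff_mul_le (Or.inl h) (Or.inl (hu i))).2 ?_
      have := mul_le_mul_right (hF1 i k hk) a
      rwa [← mul_assoc, ← mul_assoc, ENNReal.mul_inv_cancel ha0 haT, one_mul] at this
  have hqT : ∀ i k, k ≠ i → q i k ≠ ⊤ := fun i k hk =>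
    ne_top_of_le_ne_top (ENNReal.mul_ne_top haT (hp1 i k)) (hqle i k hk)
  have hG1 : ∀ i, graphSum q {i} ≤ a ^ (l - 1) * graphSum p {i} := graphSum_le hqle
  have hG2 : ∀ i, graphSum p {i} ≤ a ^ (l - 1) * graphSum q {i} := graphSum_le hqge
  have hGT : ∀ i, graphSum q {i} ≠ ⊤ := graphSum_ne_top hqT
  have hGpT : ∀ i, graphSum p {i} ≠ ⊤ := graphSum_ne_top fun i j _ => hp1 i j
  have hGp0 : ∀ i, graphSum p {i} ≠ 0 := fun i => (graphSum_pos hirr i).ne'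
  have hG0 : ∀ i, graphSum q {i} ≠ 0 := fun i h => by
    have := hG2 i
    rw [h, mul_zero] at this
    exact hGp0 i (le_antisymm this zero_le)
  have hsub : ∀ j, j ≠ o → u j * (∑ k ∈ ({j}ᶜ : Finset (Fin l)), q j k) ≤
      ∑ i ∈ ({j}ᶜ : Finset (Fin l)), u i * q i j := by
    intro j hj
    have h := hbal j hj
    rw [← hsum j, hsplit, hsplit (fun i => F i j) j] at h
    have h' := (ENNReal.add_le_add_iff_left (hFT j j)).1 h
    rw [Finset.mul_sum]
    calc _ = ∑ k ∈ ({j}ᶜ : Finset (Fin l)), F j k :=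
          Finset.sum_congr rfl fun k hk => hqu j k (by simpa using hk)
      _ ≤ _ := h'
      _ = _ := Finset.sum_congr rfl fun k hk =>
          (hqu k j (by simpa [eq_comm] using hk)).symm
  have hmain : u j * graphSum q {o} ≤ u o * graphSum q {j} := by
    have hts1 : ∀ j, (∑ k ∈ ({j}ᶜ : Finset (Fin l)), q j k).toReal =
        ∑ k ∈ ({j}ᶜ : Finset (Fin l)), (q j k).toReal := fun j =>
      ENNReal.toReal_sum fun k hk => hqT j k (by simpa using hk)
    have hts2 : ∀ (v : Fin l → ℝ≥0∞) (_ : ∀ i, v i ≠ ⊤) (j : Fin l),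
        (∑ i ∈ ({j}ᶜ : Finset (Fin l)), v i * q i j).toReal =
        ∑ i ∈ ({j}ᶜ : Finset (Fin l)), (v i).toReal * (q i j).toReal := fun v hv j => by
      rw [ENNReal.toReal_sum fun k hk =>
        ENNReal.mul_ne_top (hv k) (hqT k j (by simpa [eq_comm] using hk))]
      simp only [ENNReal.toReal_mul]
    have hsT : ∀ (v : Fin l → ℝ≥0∞) (_ : ∀ i, v i ≠ ⊤) (j : Fin l),
        ∑ i ∈ ({j}ᶜ : Finset (Fin l)), v i * q i j ≠ ⊤ := fun v hv j =>
      ENNReal.sum_ne_top.2 fun k hk =>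
        ENNReal.mul_ne_top (hv k) (hqT k j (by simpa [eq_comm] using hk))
    have key := max_principle (fun i k => (q i k).toReal) (fun i => (u i).toReal)
      (fun i => (graphSum q {i}).toReal) o (fun _ _ _ => ENNReal.toReal_nonneg)
      (fun i => ENNReal.toReal_pos (hG0 i) (hGT i)) ?_ ?_ ?_ j
    · simp only [← ENNReal.toReal_mul] at key
      exact (ENNReal.toReal_le_toReal (ENNReal.mul_ne_top (hu j) (hGT o))
        (ENNReal.mul_ne_top (hu o) (hGT j))).1 key
    · intro i
      have := congrArg ENNReal.toReal (tree_balance q i)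
      rwa [ENNReal.toReal_mul, hts1, hts2 _ hGT] at this
    · intro i hi
      have := ENNReal.toReal_mono (hsT u hu i) (hsub i hi)
      rwa [ENNReal.toReal_mul, hts1, hts2 _ hu] at this
    · intro i
      obtain ⟨n, hn⟩ := hirr o i
      refine Relation.ReflTransGen.mono ?_ _ _ (matPow_pos_reach n i hn)
      intro x y hxy hne
      refine ENNReal.toReal_pos (fun h => ?_) (hqT x y hne.symm)
      have := hqge x y hne.symm
      rw [h, mul_zero] at this
      exact hxy.ne' (le_antisymm this zero_le)
  -- conclusion
  have hpow : a * (a ^ (l - 1) * a ^ (l - 1)) ≤ a ^ (4 ^ (l - 1)) := by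
    rw [← pow_add, ← pow_succ']
    refine pow_le_pow_right₀ ha1 ?_
    obtain ⟨n, rfl⟩ : ∃ n, l = n + 2 := ⟨l - 2, by omega⟩
    have : ∀ n : ℕ, 2 * n + 3 ≤ 4 ^ (n + 1) := by
      intro n
      induction n with
      | zero => norm_num
      | succ n ih => rw [pow_succ]; omega
    have := this n
    have e : n + 2 - 1 = n + 1 := by omega
    rw [e]; omega
  have h5 : u j * graphSum p {o} ≤ u o * (a ^ (l - 1) * a ^ (l - 1)) * graphSum p {j} := by
    calc u j * graphSum p {o} ≤ u j * (a ^ (l - 1) * graphSum q {o}) := by gcongr; exact hG2 o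
      _ = a ^ (l - 1) * (u j * graphSum q {o}) := by ring
      _ ≤ a ^ (l - 1) * (u o * graphSum q {j}) := by gcongr
      _ ≤ a ^ (l - 1) * (u o * (a ^ (l - 1) * graphSum p {j})) := by gcongr; exact hG1 j
      _ = _ := by ring
  have h6 := (ENNReal.le_div_iff_mul_le (Or.inl (hGp0 o)) (Or.inl (hGpT o))).2 h5
  refine h6.trans ?_
  rw [mul_div_assoc]
  gcongr
  calc u o * (a ^ (l - 1) * a ^ (l - 1))
      ≤ (a / ∑ m ∈ ({o}ᶜ : Finset (Fin l)), p o m) * (a ^ (l - 1) * a ^ (l - 1)) := by gcongr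
    _ = (a * (a ^ (l - 1) * a ^ (l - 1))) / ∑ m ∈ ({o}ᶜ : Finset (Fin l)), p o m := by
        rw [ENNReal.mul_div_right_comm]
    _ ≤ _ := by gcongr

/-! ### Path measures -/

theorem cylProb_measurable (κ : Kernel X X) [IsMarkovKernel κ] (As : List (Set X))
    (hA : ∀ A ∈ As, MeasurableSet A) : Measurable fun y => cylProb κ y As := by
  induction As with
  | nil => exact measurable_const
  | cons A As ih =>
    simp only [cylProb]
    exact Measurable.setLIntegral_kernel (ih fun B hB => hA B (List.mem_cons_of_mem _ hB))
      (hA A List.mem_cons_self)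

/-- Law of the chain at time `n`, restricted to paths with `ω k ∈ A k` for `k ≤ n`. -/
noncomputable def seqM (κ : Kernel X X) (μ : Measure X) (A : ℕ → Set X) : ℕ → Measure X
  | 0 => μ.restrict (A 0)
  | n + 1 => ((seqM κ μ A n).bind κ).restrict (A (n + 1))

theorem seqM_front (κ : Kernel X X) (μ : Measure X) (A : ℕ → Set X) (n : ℕ) :
    seqM κ μ A (n + 1) = seqM κ ((μ.restrict (A 0)).bind κ) (fun k => A (k + 1)) n := by
  induction n with
  | zero => rfl
  | succ n ih =>
    rw [seqM, ih]; rfl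

theorem seqM_congr (κ : Kernel X X) (μ : Measure X) (A B : ℕ → Set X) (n : ℕ)
    (h : ∀ k ≤ n, A k = B k) : seqM κ μ A n = seqM κ μ B n := by
  induction n with
  | zero => simp only [seqM, h 0 le_rfl]
  | succ n ih =>
    simp only [seqM, h (n + 1) le_rfl, ih fun k hk => h k (by omega)]

theorem lintegral_cylProb (κ : Kernel X X) [IsMarkovKernel κ] (n : ℕ) :
    ∀ (μ : Measure X) (A : ℕ → Set X) (_ : ∀ k, MeasurableSet (A k)),
      ∫⁻ y in A 0, cylProb κ y ((List.range n).map fun k => A (k + 1)) ∂μ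
        = seqM κ μ A n Set.univ := by
  induction n with
  | zero => intro μ A hA; simp [cylProb, seqM]
  | succ n ih =>
    intro μ A hA
    rw [seqM_front, ← ih _ (fun k => A (k + 1)) fun k => hA _]
    rw [List.range_succ_eq_map, List.map_cons, List.map_map]
    simp only [cylProb]
    have hm : Measurable fun y => cylProb κ y ((List.range n).map fun k => A (k + 1 + 1)) :=
      cylProb_measurable κ _ (by
        intro B hB
        obtain ⟨k, -, rfl⟩ := List.mem_map.1 hB
        exact hA _)
    rw [← lintegral_indicator (hA (0 + 1)), Measure.lintegral_bind κ.measurable.aemeasurable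
      (hm.indicator (hA _)).aemeasurable]
    refine lintegral_congr fun y => ?_
    rw [lintegral_indicator (hA (0 + 1))]
    rfl

theorem cyl_eq (κ : Kernel X X) [IsMarkovKernel κ] (Q : X → Measure (ℕ → X))
    (hQ : IsMarkovChainLawKernel κ Q) (x : X) (n : ℕ) (A : ℕ → Set X)
    (hA : ∀ k, MeasurableSet (A k)) (B : Set X) (hB : MeasurableSet B) :
    Q x {ω | (∀ k ≤ n, ω k ∈ A k) ∧ ω n ∈ B} = seqM κ (Measure.dirac x) A n B := by
  have hgen : ∀ A : ℕ → Set X, (∀ k, MeasurableSet (A k)) →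
      Q x {ω | ∀ k ≤ n, ω k ∈ A k} = seqM κ (Measure.dirac x) A n Set.univ := by
    intro A hA
    rw [hQ.2 x n A hA, ← lintegral_cylProb κ n _ A hA]
    have hm : Measurable fun y => cylProb κ y ((List.range n).map fun k => A (k + 1)) :=
      cylProb_measurable κ _ (by
        intro B hB
        obtain ⟨k, -, rfl⟩ := List.mem_map.1 hB
        exact hA _)
    rw [← lintegral_indicator (hA 0), lintegral_dirac' _ (hm.indicator (hA _))]
    by_cases h : x ∈ A 0 <;> simp [h]
  set A' : ℕ → Set X := fun k => if k = n then A n ∩ B else A k with hA'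
  have hset : {ω : ℕ → X | (∀ k ≤ n, ω k ∈ A k) ∧ ω n ∈ B} = {ω | ∀ k ≤ n, ω k ∈ A' k} := by
    ext ω
    simp only [Set.mem_ofPred_eq, hA']
    constructor
    · rintro ⟨h1, h2⟩ k hk
      by_cases hkn : k = n
      · subst hkn; rw [if_pos rfl]; exact ⟨h1 k le_rfl, h2⟩
      · rw [if_neg hkn]; exact h1 k hk
    · intro h
      have hn := h n le_rfl
      rw [if_pos rfl] at hn
      refine ⟨fun k hk => ?_, hn.2⟩
      by_cases hkn : k = n
      · subst hkn; exact hn.1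
      · have := h k hk
        rwa [if_neg hkn] at this
  have hA'm : ∀ k, MeasurableSet (A' k) := fun k => by
    simp only [hA']
    split_ifs
    · exact (hA n).inter hB
    · exact hA k
  rw [hset, hgen A' hA'm]
  cases n with
  | zero =>
    simp only [seqM, hA', if_true]
    rw [Measure.restrict_apply_univ, Measure.restrict_apply hB, Set.inter_comm]
  | succ n =>
    simp only [seqM]
    rw [seqM_congr κ _ A' A n fun k hk => by
      simp only [hA']; rw [if_neg (by omega)]]
    simp only [hA', if_true]
    rw [Measure.restrict_apply_univ, Measure.restrict_apply hB, Set.inter_comm]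

instance seqM_finite (κ : Kernel X X) [IsMarkovKernel κ] (μ : Measure X) [IsFiniteMeasure μ]
    (A : ℕ → Set X) (n : ℕ) : IsFiniteMeasure (seqM κ μ A n) := by
  induction n with
  | zero => simp only [seqM]; infer_instance
  | succ n ih => simp only [seqM]; infer_instance

/-- Stay in `O` up to time `m`, outside `O` afterwards. -/
def phase (O : Set X) (m : ℕ) : ℕ → Set X := fun i => if i ≤ m then O else Oᶜ

/-- Law at time `m + k` on the event that the exit from `O` takes place at time `m + 1`
(when `k ≥ 1`) and the chain has not returned. -/
noncomputable def gam (κ : Kernel X X) (x : X) (O : Set X) (m k : ℕ) : Measure X :=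
  seqM κ (Measure.dirac x) (phase O m) (m + k)

theorem gam_succ (κ : Kernel X X) (x : X) (O : Set X) (m k : ℕ) :
    gam κ x O m (k + 1) = ((gam κ x O m k).bind κ).restrict Oᶜ := by
  unfold gam
  rw [← add_assoc, seqM]
  simp [phase]

theorem gam_zero_succ (κ : Kernel X X) (x : X) (O : Set X) (m : ℕ) :
    gam κ x O (m + 1) 0 = ((gam κ x O m 0).bind κ).restrict O := by
  unfold gam
  rw [add_zero, add_zero, seqM, seqM_congr κ _ (phase O (m + 1)) (phase O m) m]
  · simp [phase]
  · intro k hk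
    simp only [phase]
    rw [if_pos hk, if_pos (by omega)]

theorem gam_zero_zero (κ : Kernel X X) (x : X) (O : Set X) :
    gam κ x O 0 0 = (Measure.dirac x).restrict O := by
  simp [gam, seqM, phase]

theorem gam_zero_restrict (κ : Kernel X X) (x : X) (O : Set X) (hO : MeasurableSet O) (m : ℕ) :
    (gam κ x O m 0).restrict O = gam κ x O m 0 := by
  cases m with
  | zero => rw [gam_zero_zero, Measure.restrict_restrict hO, Set.inter_self]
  | succ m => rw [gam_zero_succ, Measure.restrict_restrict hO, Set.inter_self]

instance gam_finite (κ : Kernel X X) [IsMarkovKernel κ] (x : X) (O : Set X) (m k : ℕ) :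
    IsFiniteMeasure (gam κ x O m k) := by
  unfold gam; infer_instance

/-- Box sums of the occupation measures satisfy the bound. -/
theorem box_bound {l : ℕ} (hl : 2 ≤ l)
    (p : Fin l → Fin l → ℝ≥0∞) (hrow : ∀ i, ∑ j, p i j = 1)
    (hirr : Irreducible p)
    (Xs : Fin l → Set X) (hXmeas : ∀ i, MeasurableSet (Xs i))
    (hXdisj : Pairwise fun i j => Disjoint (Xs i) (Xs j))
    (hXcover : (⋃ i, Xs i) = Set.univ)
    (κ : Kernel X X) (hκ : IsMarkovKernel κ)
    (a : ℝ≥0∞) (ha1 : 1 ≤ a) (haT : a ≠ ⊤)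
    (hcomp : ∀ (i j : Fin l), j ≠ i → ∀ x ∈ Xs i,
      a⁻¹ * p i j ≤ κ x (Xs j) ∧ κ x (Xs j) ≤ a * p i j)
    (o : Fin l) (j : Fin l) (x : X) (M K : ℕ) :
    ∑ m ∈ Finset.range M, ∑ k ∈ Finset.range (K + 1), gam κ x (Xs o) m k (Xs j)
      ≤ (a ^ (4 ^ (l - 1)) / ∑ m ∈ ({o}ᶜ : Finset (Fin l)), p o m) *
          (graphSum p {j} / graphSum p {o}) := by
  have hκm : ∀ j, Measurable fun y => κ y (Xs j) := fun j => κ.measurable_coe (hXmeas j)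
  have hpart : ∀ (ν : Measure X) (f : X → ℝ≥0∞), ∑ i, ∫⁻ y in Xs i, f y ∂ν = ∫⁻ y, f y ∂ν := by
    intro ν f
    rw [← setLIntegral_univ, ← hXcover, lintegral_iUnion hXmeas hXdisj, tsum_fintype]
  refine flow_bound hl p hrow hirr a ha1 haT o
    (fun i => ∑ m ∈ Finset.range M, ∑ k ∈ Finset.range (K + 1), gam κ x (Xs o) m k (Xs i))
    (fun i j => ∑ m ∈ Finset.range M, ∑ k ∈ Finset.range (K + 1),
      ∫⁻ y in Xs i, κ y (Xs j) ∂(gam κ x (Xs o) m k)) ?_ ?_ ?_ ?_ ?_ ?_ j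
  · intro i
    exact ENNReal.sum_ne_top.2 fun m _ => ENNReal.sum_ne_top.2 fun k _ => measure_ne_top _ _
  · intro i j hij
    simp only [Finset.mul_sum]
    refine Finset.sum_le_sum fun m _ => Finset.sum_le_sum fun k _ => ?_
    rw [← setLIntegral_const]
    exact setLIntegral_mono (hκm j) fun y hy => (hcomp i j hij y hy).1
  · intro i j hij
    simp only [Finset.mul_sum]
    refine Finset.sum_le_sum fun m _ => Finset.sum_le_sum fun k _ => ?_
    rw [← setLIntegral_const]
    exact setLIntegral_mono measurable_const fun y hy => (hcomp i j hij y hy).2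
  · intro i
    rw [Finset.sum_comm]
    refine Finset.sum_congr rfl fun m _ => ?_
    rw [Finset.sum_comm]
    refine Finset.sum_congr rfl fun k _ => ?_
    rw [← lintegral_finsetSum _ fun j _ => hκm j]
    have h1 : ∀ y, ∑ j, κ y (Xs j) = 1 := fun y => by
      rw [← tsum_fintype (L := SummationFilter.unconditional _),
        ← measure_iUnion hXdisj hXmeas, hXcover, measure_univ]
    simp [h1]
  · intro j hj
    beta_reduce
    rw [Finset.sum_comm (s := Finset.univ)]
    refine Finset.sum_le_sum fun m _ => ?_
    rw [Finset.sum_comm (s := Finset.univ)]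
    simp only [hpart]
    rw [Finset.sum_range_succ']
    have hz : gam κ x (Xs o) m 0 (Xs j) = 0 := by
      rw [← gam_zero_restrict κ x _ (hXmeas o), Measure.restrict_apply (hXmeas j),
        (hXdisj hj).inter_eq, measure_empty]
    rw [hz, add_zero]
    refine le_trans (b := ∑ k ∈ Finset.range K, ∫⁻ y, κ y (Xs j) ∂(gam κ x (Xs o) m k))
      (Finset.sum_le_sum fun k _ => ?_)
      (Finset.sum_le_sum_of_subset (Finset.range_mono (Nat.le_succ K)))
    rw [gam_succ]
    refine (Measure.restrict_apply_le _ _).trans ?_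
    rw [Measure.bind_apply (hXmeas j) κ.measurable.aemeasurable]
  · have h1 : ∀ m, ∑ k ∈ Finset.range (K + 1), gam κ x (Xs o) m k (Xs o)
        = gam κ x (Xs o) m 0 (Xs o) := by
      intro m
      rw [Finset.sum_range_succ', Finset.sum_eq_zero, zero_add]
      intro k _
      rw [gam_succ, Measure.restrict_apply (hXmeas o), Set.inter_compl_self, measure_empty]
    simp only [h1]
    refine le_trans (Finset.sum_le_sum_of_subset (Finset.range_mono (Nat.le_succ M))) ?_
    rw [Finset.sum_range_succ', add_comm]
    refine add_le_add ?_ (Finset.sum_le_sum fun m _ => ?_)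
    · rw [gam_zero_zero]
      exact (Measure.restrict_apply_le _ _).trans prob_le_one
    · refine le_trans ?_ (Finset.single_le_sum (f := fun k =>
        ∫⁻ y in Xs o, κ y (Xs o) ∂(gam κ x (Xs o) m k)) (fun _ _ => zero_le)
        (Finset.mem_range.2 (Nat.succ_pos K)))
      simp only [gam_zero_restrict κ x _ (hXmeas o)]
      rw [gam_zero_succ]
      refine (Measure.restrict_apply_le _ _).trans ?_
      rw [Measure.bind_apply (hXmeas o) κ.measurable.aemeasurable]

theorem visit_decomp {l : ℕ} (Xs : Fin l → Set X) (hXcover : (⋃ i, Xs i) = Set.univ)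
    (o j : Fin l) (ω : ℕ → X) (h0 : ω 0 ∈ Xs o) (n : ℕ) (hn : (n : ℝ≥0∞) < retMS Xs o ω)
    (hj : ω n ∈ Xs j) :
    ∃ z : ℕ × ℕ, z ∈ Finset.HasAntidiagonal.antidiagonal n ∧
      (∀ i ≤ z.1 + z.2, ω i ∈ phase (Xs o) z.1 i) ∧ ω (z.1 + z.2) ∈ Xs j := by
  by_cases hall : ∀ i ≤ n, ω i ∈ Xs o
  · refine ⟨(n, 0), by simp, fun i hi => ?_, by simpa using hj⟩
    have hi' : i ≤ n := by simpa using hi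
    simp only [phase, if_pos hi']
    exact hall i hi'
  · push Not at hall
    have hs := Nat.find_spec hall
    have hmin : ∀ i, i < Nat.find hall → ω i ∈ Xs o := fun i hi => by
      by_contra hc
      exact Nat.find_min hall hi ⟨hi.le.trans hs.1, hc⟩
    set s := Nat.find hall with hsdef
    have hspos : s ≠ 0 := fun e => hs.2 (by rw [e]; exact h0)
    refine ⟨(s - 1, n - (s - 1)), by simp; omega, fun i hi => ?_, ?_⟩
    · have hi' : i ≤ n := by simp only at hi; omega
      simp only [phase]
      split_ifs with h
      · exact hmin i (by omega)
      · intro hio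
        have hit : hitS (⋃ (j) (_ : j ≠ o), Xs j) ω ≤ (s : ℝ≥0∞) := by
          refine iInf₂_le (f := fun n (_ : n ∈ {n : ℕ | ω n ∈ ⋃ (j) (_ : j ≠ o), Xs j}) =>
            (n : ℝ≥0∞)) s ?_
          have : ω s ∈ ⋃ i, Xs i := by rw [hXcover]; trivial
          obtain ⟨t, ht⟩ := Set.mem_iUnion.1 this
          simp only [Set.mem_ofPred_eq, Set.mem_iUnion]
          refine ⟨t, fun e => hs.2 (e ▸ ht), ht⟩
        have hret : retMS Xs o ω ≤ (i : ℝ≥0∞) := by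
          refine iInf₂_le (f := fun n (_ : n ∈ {n : ℕ | hitS (⋃ (j) (_ : j ≠ o), Xs j) ω
            ≤ (n : ℝ≥0∞) ∧ ω n ∈ Xs o}) => (n : ℝ≥0∞)) i ?_
          refine ⟨hit.trans ?_, hio⟩
          exact_mod_cast (by omega : s ≤ i)
        have := hn.trans_le hret
        have : n < i := by exact_mod_cast this
        omega
    · have e : s - 1 + (n - (s - 1)) = n := by omega
      simpa only [e] using hj

theorem measurable_phase {O : Set X} (hO : MeasurableSet O) (m i : ℕ) :
    MeasurableSet (phase O m i) := by
  unfold phase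
  split_ifs
  · exact hO
  · exact hO.compl

theorem visits_le_tsum {l : ℕ}
    (Xs : Fin l → Set X) (hXmeas : ∀ i, MeasurableSet (Xs i))
    (hXcover : (⋃ i, Xs i) = Set.univ)
    (κ : Kernel X X) (hκ : IsMarkovKernel κ)
    (Q : X → Measure (ℕ → X)) (hQ : IsMarkovChainLawKernel κ Q)
    (o : Fin l) (j : Fin l) (x : X) (hx : x ∈ Xs o) :
    (∫⁻ ω, numVisitsM Xs o j ω ∂ Q x) ≤ ∑' (m : ℕ) (k : ℕ), gam κ x (Xs o) m k (Xs j) := by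
  have := hQ.1 x
  set C : ℕ → ℕ → Set (ℕ → X) := fun m k =>
    {ω | (∀ i ≤ m + k, ω i ∈ phase (Xs o) m i) ∧ ω (m + k) ∈ Xs j} with hC
  have hCm : ∀ m k, MeasurableSet (C m k) := by
    intro m k
    have : C m k = (⋂ i, ⋂ (_ : i ≤ m + k), (fun ω : ℕ → X => ω i) ⁻¹' phase (Xs o) m i) ∩
        (fun ω : ℕ → X => ω (m + k)) ⁻¹' Xs j := by
      ext ω; simp [hC]
    rw [this]
    refine MeasurableSet.inter (MeasurableSet.iInter fun i => MeasurableSet.iInter fun _ => ?_) ?_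
    · exact measurable_pi_apply i (measurable_phase (hXmeas o) m i)
    · exact measurable_pi_apply (m + k) (hXmeas j)
  have h0 : ∀ᵐ ω ∂(Q x), ω 0 ∈ Xs o := by
    have h := cyl_eq κ Q hQ x 0 (fun _ => Set.univ) (fun _ => MeasurableSet.univ) (Xs o) (hXmeas o)
    simp only [Set.mem_univ, implies_true, true_and, seqM, Measure.restrict_univ] at h
    rw [Measure.dirac_apply' _ (hXmeas o), Set.indicator_of_mem hx] at h
    have hm : MeasurableSet {ω : ℕ → X | ω 0 ∈ Xs o} := measurable_pi_apply 0 (hXmeas o)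
    exact (prob_compl_eq_zero_iff hm).2 h
  calc (∫⁻ ω, numVisitsM Xs o j ω ∂ Q x)
      ≤ ∫⁻ ω, ∑' z : ℕ × ℕ, (C z.1 z.2).indicator 1 ω ∂ Q x := by
        refine lintegral_mono_ae ?_
        filter_upwards [h0] with ω hω
        rw [← Finset.HasAntidiagonal.sigmaAntidiagonalEquivProd.tsum_eq, ENNReal.tsum_sigma']
        unfold numVisitsM
        refine ENNReal.tsum_le_tsum fun n => ?_
        split_ifs with hcond
        · obtain ⟨z, hz, hz1⟩ := visit_decomp Xs hXcover o j ω hω n hcond.1 hcond.2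
          refine le_trans ?_ (ENNReal.le_tsum (⟨z, hz⟩ : Finset.HasAntidiagonal.antidiagonal n))
          simp only [Finset.HasAntidiagonal.sigmaAntidiagonalEquivProd_apply]
          rw [Set.indicator_of_mem (show ω ∈ C z.1 z.2 from hz1)]
          exact le_rfl
        · exact zero_le
    _ = ∑' z : ℕ × ℕ, Q x (C z.1 z.2) := by
        rw [lintegral_tsum fun z => (measurable_one.indicator (hCm _ _)).aemeasurable]
        exact tsum_congr fun z => lintegral_indicator_one (hCm _ _)
    _ = ∑' (m : ℕ) (k : ℕ), Q x (C m k) := ENNReal.tsum_prod (f := fun m k => Q x (C m k))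
    _ = _ := by
        refine tsum_congr fun m => tsum_congr fun k => ?_
        exact cyl_eq κ Q hQ x (m + k) (phase (Xs o) m) (measurable_phase (hXmeas o) m) _ (hXmeas j)

/-- For every `j` and every `x ∈ 𝒳_1` (the distinguished index `1` being
denoted `o`): `E_x[Ñ_j] ≤ (a^{4^{l−1}} / Σ_{m ∈ L∖{1}} p_{1m}) · (Σ_{g∈G(j)} π(g) / Σ_{g∈G(1)} π(g))`. -/
theorem expected_visits_le {l : ℕ} (hl : 2 ≤ l)
    (p : Fin l → Fin l → ℝ≥0∞) (hrow : ∀ i, ∑ j, p i j = 1)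
    (hirr : Irreducible p)
    (Xs : Fin l → Set X) (hXmeas : ∀ i, MeasurableSet (Xs i))
    (hXdisj : Pairwise fun i j => Disjoint (Xs i) (Xs j))
    (hXcover : (⋃ i, Xs i) = Set.univ)
    (κ : Kernel X X) (hκ : IsMarkovKernel κ)
    (Q : X → Measure (ℕ → X)) (hQ : IsMarkovChainLawKernel κ Q)
    (a : ℝ≥0∞) (ha1 : 1 ≤ a) (haT : a ≠ ⊤)
    (hcomp : ∀ (i j : Fin l), j ≠ i → ∀ x ∈ Xs i,
      a⁻¹ * p i j ≤ κ x (Xs j) ∧ κ x (Xs j) ≤ a * p i j)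
    (o : Fin l) (j : Fin l) (x : X) (hx : x ∈ Xs o) :
    (∫⁻ ω, numVisitsM Xs o j ω ∂ Q x)
      ≤ (a ^ (4 ^ (l - 1)) / ∑ m ∈ ({o}ᶜ : Finset (Fin l)), p o m) *
          (graphSum p {j} / graphSum p {o}) := by
  refine (visits_le_tsum Xs hXmeas hXcover κ hκ Q hQ o j x hx).trans ?_
  refine ENNReal.tsum_le_of_sum_range_le fun M => ?_
  rw [← Summable.tsum_finsetSum fun _ _ => ENNReal.summable]
  refine ENNReal.tsum_le_of_sum_range_le fun K => ?_
  refine le_trans (Finset.sum_le_sum_of_subset (Finset.range_mono (Nat.le_succ K))) ?_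
  rw [Finset.sum_comm]
  exact box_bound hl p hrow hirr Xs hXmeas hXdisj hXcover κ hκ a ha1 haT hcomp o j x M K

end FW
end

section
/- For every j ∈ L∖{1}: Σ_{ℓ=1}^{∞} sup_{x∈𝒳_j} P_x(Ñ_j ≥ ℓ) ≤ a^{4^{l−1}} · ( Σ_{g∈G(1,j)} π(g) / Σ_{g∈G(1)} π(g) ); moreover, Σ_{ℓ=1}^{∞} sup_{x∈𝒳_1} P_x(Ñ_1 ≥ ℓ) ≤ a / ( Σ_{ℓ∈L∖{1}} p_{1ℓ} ). -/
open MeasureTheory ProbabilityTheory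
open scoped ENNReal Classical

namespace FW

variable {X : Type} [MeasurableSpace X]

/-! ### Combinatorics of `W`-graphs -/

/-- `k` is led to `w` by the arrows of `f`. -/
def Lead {l : ℕ} (f : Fin l → Fin l) (k w : Fin l) : Prop := ∃ n : ℕ, f^[n] k = w

lemma Lead.step {l : ℕ} {f : Fin l → Fin l} {k w : Fin l} (h : Lead f (f k) w) : Lead f k w := by
  obtain ⟨n, hn⟩ := h
  exact ⟨n + 1, by rw [Function.iterate_succ_apply]; exact hn⟩

lemma Lead.self {l : ℕ} (f : Fin l → Fin l) (k : Fin l) : Lead f k k := ⟨0, rfl⟩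

lemma Lead.unique {l : ℕ} {f : Fin l → Fin l} {k w v : Fin l} (hw : f w = w) (hv : f v = v)
    (h1 : Lead f k w) (h2 : Lead f k v) : w = v := by
  obtain ⟨n, hn⟩ := h1
  obtain ⟨m, hm⟩ := h2
  have e1 : f^[m + n] k = w := by
    rw [Function.iterate_add_apply, hn, Function.iterate_fixed hw]
  have e2 : f^[n + m] k = v := by
    rw [Function.iterate_add_apply, hm, Function.iterate_fixed hv]
  rw [← e1, ← e2, Nat.add_comm]

lemma isWGraph_iff {l : ℕ} {W : Finset (Fin l)} {g : Fin l → Fin l} :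
    IsWGraph W g ↔ (∀ i ∈ W, g i = i) ∧ ∀ k, ∃ w ∈ W, Lead g k w := by
  constructor
  · rintro ⟨h1, h2⟩
    refine ⟨h1, fun k => ?_⟩
    by_cases hk : k ∈ W
    · exact ⟨k, hk, Lead.self _ _⟩
    · obtain ⟨n, hn⟩ := (h2 k hk).2
      exact ⟨_, hn, n, rfl⟩
  · rintro ⟨h1, h2⟩
    refine ⟨h1, fun k hk => ?_⟩
    obtain ⟨w, hw, n, hn⟩ := h2 k
    refine ⟨fun hfix => ?_, n, by rw [hn]; exact hw⟩
    rw [Function.iterate_fixed hfix] at hn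
    exact hk (hn ▸ hw)

lemma lead_update_of_not {l : ℕ} {f : Fin l → Fin l} {i m k w : Fin l}
    (hk : ¬ Lead f k i) : Lead (Function.update f i m) k w ↔ Lead f k w := by
  have key : ∀ n, (Function.update f i m)^[n] k = f^[n] k := by
    intro n
    induction n with
    | zero => rfl
    | succ n ih =>
      rw [Function.iterate_succ_apply', Function.iterate_succ_apply', ih,
        Function.update_of_ne]
      exact fun h => hk ⟨n, h⟩
  simp only [Lead, key]

lemma lead_update_self {l : ℕ} {f : Fin l → Fin l} {i m k : Fin l}
    (hk : Lead f k i) : Lead (Function.update f i m) k i := by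
  obtain ⟨n, hn⟩ := hk
  induction n generalizing k with
  | zero => exact ⟨0, hn⟩
  | succ n ih =>
    by_cases hki : k = i
    · subst hki; exact Lead.self _ _
    · apply Lead.step
      rw [Function.update_of_ne hki]
      exact ih (by rw [← Function.iterate_succ_apply]; exact hn)

lemma Lead.trans {l : ℕ} {f : Fin l → Fin l} {k w v : Fin l} (h1 : Lead f k w)
    (h2 : Lead f w v) : Lead f k v := by
  obtain ⟨n, hn⟩ := h1
  obtain ⟨m, hm⟩ := h2
  exact ⟨m + n, by rw [Function.iterate_add_apply, hn, hm]⟩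

lemma lead_update_of_lead {l : ℕ} {f : Fin l → Fin l} {i m k w : Fin l}
    (hm : ¬ Lead f m i) (hk : Lead f k i) (hmw : Lead f m w) :
    Lead (Function.update f i m) k w := by
  refine (lead_update_self hk).trans (Lead.step ?_)
  rw [Function.update_self]
  exact (lead_update_of_not hm).2 hmw

lemma isWGraph_update_s10 {l : ℕ} {W : Finset (Fin l)} {i : Fin l} (hi : i ∉ W)
    {f : Fin l → Fin l} (hf : IsWGraph (insert i W) f) {m : Fin l} (hm : ¬ Lead f m i) :
    IsWGraph W (Function.update f i m) := by
  rw [isWGraph_iff] at hf ⊢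
  obtain ⟨h1, h2⟩ := hf
  refine ⟨fun t ht => ?_, fun k => ?_⟩
  · rw [Function.update_of_ne (by rintro rfl; exact hi ht)]
    exact h1 t (Finset.mem_insert_of_mem ht)
  · have key : ∀ k, ¬ Lead f k i → ∃ w ∈ W, Lead f k w := by
      intro k hk
      obtain ⟨w, hw, hl⟩ := h2 k
      rcases Finset.mem_insert.1 hw with rfl | hw
      · exact absurd hl hk
      · exact ⟨w, hw, hl⟩
    by_cases hk : Lead f k i
    · obtain ⟨w, hw, hl⟩ := key m hm
      exact ⟨w, hw, lead_update_of_lead hm hk hl⟩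
    · obtain ⟨w, hw, hl⟩ := key k hk
      exact ⟨w, hw, (lead_update_of_not hk).2 hl⟩

lemma isWGraph_cut {l : ℕ} {W : Finset (Fin l)} {i : Fin l} (hi : i ∉ W)
    {g : Fin l → Fin l} (hg : IsWGraph W g) :
    IsWGraph (insert i W) (Function.update g i i) ∧
      ¬ Lead (Function.update g i i) (g i) i := by
  rw [isWGraph_iff] at hg ⊢
  obtain ⟨h1, h2⟩ := hg
  refine ⟨⟨fun t ht => ?_, fun k => ?_⟩, fun h => ?_⟩
  · by_cases hti : t = i
    · subst hti; simp
    · rw [Function.update_of_ne hti]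
      exact h1 t ((Finset.mem_insert.1 ht).resolve_left hti)
  · by_cases hk : Lead g k i
    · exact ⟨i, Finset.mem_insert_self _ _, lead_update_self hk⟩
    · obtain ⟨w, hw, hl⟩ := h2 k
      exact ⟨w, Finset.mem_insert_of_mem hw, (lead_update_of_not hk).2 hl⟩
  · have h' : Lead g (g i) i := by
      have := lead_update_self (m := g i) h
      simpa using this
    obtain ⟨n, hn⟩ := h'
    obtain ⟨w, hw, t, ht⟩ := h2 i
    have hper : Function.IsPeriodicPt g (n + 1) i := by
      rw [Function.IsPeriodicPt, Function.IsFixedPt, Function.iterate_succ_apply]; exact hn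
    have hp2 : g^[t * (n + 1)] i = i := (hper.const_mul t)
    have hle : t * (n + 1) = t * n + t := by ring
    rw [hle, Function.iterate_add_apply, ht, Function.iterate_fixed (h1 w hw)] at hp2
    exact hi (hp2 ▸ hw)

/-- weighted sum over `W`-graphs -/
noncomputable def gSum {l : ℕ} (q : Fin l → Fin l → ℝ) (W : Finset (Fin l))
    (F : (Fin l → Fin l) → ℝ) : ℝ :=
  ∑ g ∈ Finset.univ.filter (IsWGraph W), (∏ t ∈ Wᶜ, q t (g t)) * F g

lemma gSum_cut {l : ℕ} (q : Fin l → Fin l → ℝ) {W : Finset (Fin l)} {i : Fin l} (hi : i ∉ W)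
    (F : (Fin l → Fin l) → ℝ) :
    gSum q W F = gSum q (insert i W)
      (fun f => ∑ m ∈ Finset.univ.filter (fun m => ¬ Lead f m i),
        q i m * F (Function.update f i m)) := by
  unfold gSum
  simp only [Finset.mul_sum]
  rw [Finset.sum_sigma']
  refine Finset.sum_bij' (fun g _ => ⟨Function.update g i i, g i⟩)
    (fun s _ => Function.update s.1 i s.2) ?_ ?_ ?_ ?_ ?_
  · intro g hg
    have := isWGraph_cut hi (Finset.mem_filter.1 hg).2
    simp [this.1, this.2]
  · rintro ⟨f, m⟩ hs
    simp only [Finset.mem_sigma, Finset.mem_filter, Finset.mem_univ, true_and] at hs ⊢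
    exact isWGraph_update_s10 hi hs.1 hs.2
  · intro g hg
    simp
  · rintro ⟨f, m⟩ hs
    simp only [Finset.mem_sigma, Finset.mem_filter, Finset.mem_univ, true_and] at hs
    have : f i = i := hs.1.1 i (Finset.mem_insert_self _ _)
    simp [this]
  · intro g hg
    have hc : (Wᶜ : Finset (Fin l)) = insert i (insert i W)ᶜ := by
      ext t; by_cases h : t = i
      · subst h; simp [hi]
      · simp [h]
    rw [hc, Finset.prod_insert (by simp)]
    simp only [Function.update_idem, Function.update_eq_self]
    have : ∏ t ∈ (insert i W)ᶜ, q t (Function.update g i i t)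
        = ∏ t ∈ (insert i W)ᶜ, q t (g t) := by
      refine Finset.prod_congr rfl fun t ht => ?_
      rw [Function.update_of_ne]
      rintro rfl
      simp at ht
    rw [this]; ring

lemma gSum_nonneg {l : ℕ} {q : Fin l → Fin l → ℝ} (hq : ∀ i k, 0 ≤ q i k) (W : Finset (Fin l))
    {F : (Fin l → Fin l) → ℝ} (hF : ∀ g, 0 ≤ F g) : 0 ≤ gSum q W F :=
  Finset.sum_nonneg fun _ _ => mul_nonneg (Finset.prod_nonneg fun _ _ => hq _ _) (hF _)

/-- the weight of the `{o,j}`-graphs leading `k` to `o` -/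
noncomputable def wt {l : ℕ} (q : Fin l → Fin l → ℝ) (o j k : Fin l) : ℝ :=
  gSum q {o, j} (fun g => if Lead g k o then 1 else 0)

lemma gSum_congr {l : ℕ} {q : Fin l → Fin l → ℝ} {W : Finset (Fin l)}
    {F F' : (Fin l → Fin l) → ℝ} (h : ∀ g, IsWGraph W g → F g = F' g) :
    gSum q W F = gSum q W F' :=
  Finset.sum_congr rfl fun g hg => by rw [h g (Finset.mem_filter.1 hg).2]

lemma gSum_sum {l : ℕ} {q : Fin l → Fin l → ℝ} {W : Finset (Fin l)} (c : Fin l → ℝ)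
    (F : Fin l → (Fin l → Fin l) → ℝ) :
    ∑ k, c k * gSum q W (F k) = gSum q W (fun g => ∑ k, c k * F k g) := by
  unfold gSum
  simp only [Finset.mul_sum]
  rw [Finset.sum_comm]
  refine Finset.sum_congr rfl fun g _ => Finset.sum_congr rfl fun k _ => by ring

lemma wt_root {l : ℕ} (q : Fin l → Fin l → ℝ) (o j : Fin l) :
    wt q o j o = gSum q {o, j} (fun _ => 1) := by
  unfold wt
  exact gSum_congr fun g _ => by simp [Lead.self]

lemma wt_other {l : ℕ} (q : Fin l → Fin l → ℝ) {o j : Fin l} (hj : j ≠ o) :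
    wt q o j j = 0 := by
  unfold wt
  have : gSum q {o, j} (fun g => if Lead g j o then 1 else 0) = gSum q {o, j} (fun _ => 0) := by
    refine gSum_congr fun g hg => ?_
    rw [if_neg]
    intro h
    exact hj (Lead.unique (hg.1 j (by simp)) (hg.1 o (by simp)) (Lead.self _ _) h)
  rw [this]; simp [gSum]

lemma gSum_single {l : ℕ} (q : Fin l → Fin l → ℝ) {o j : Fin l} (hj : j ≠ o) :
    gSum q {o} (fun _ => 1) = ∑ k, q j k * wt q o j k := by
  unfold wt
  rw [gSum_sum, gSum_cut q (W := {o}) (i := j) (by simpa using hj), Finset.pair_comm j o]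
  refine gSum_congr fun g hg => ?_
  rw [Finset.sum_filter]
  refine Finset.sum_congr rfl fun m _ => ?_
  have : ¬ Lead g m j ↔ Lead g m o := by
    constructor
    · intro h
      obtain ⟨w, hw, hl⟩ := (isWGraph_iff.1 hg).2 m
      simp only [Finset.mem_insert, Finset.mem_singleton] at hw
      rcases hw with rfl | rfl
      · exact hl
      · exact absurd hl h
    · intro h h'
      exact hj (Lead.unique (hg.1 j (by simp)) (hg.1 o (by simp)) h' h)
  by_cases h : Lead g m o
  · simp [h, this.2 h]
  · simp [h, not_not.1 (mt this.1 h)]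

lemma wt_cut {l : ℕ} (q : Fin l → Fin l → ℝ) {o j i : Fin l} (hio : i ≠ o) (hij : i ≠ j)
    (k : Fin l) :
    wt q o j k = gSum q (insert i {o, j}) (fun f => ∑ m, q i m *
      ((1 - if Lead f m i then 1 else 0) *
        ((if Lead f k i then 1 else 0) * (if Lead f m o then 1 else 0) +
          (1 - if Lead f k i then 1 else 0) * (if Lead f k o then 1 else 0)))) := by
  unfold wt
  rw [gSum_cut q (W := {o, j}) (i := i) (by simp [hio, hij])]
  refine gSum_congr fun f hf => ?_
  rw [Finset.sum_filter]
  refine Finset.sum_congr rfl fun m _ => ?_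
  by_cases hm : Lead f m i
  · simp [hm]
  simp only [hm, not_false_eq_true, if_true, if_false, sub_zero, one_mul]
  congr 1
  by_cases hk : Lead f k i
  · have hG := isWGraph_update_s10 (by simp [hio, hij]) hf hm
    have : Lead (Function.update f i m) k o ↔ Lead f m o := by
      constructor
      · intro h
        obtain ⟨w, hw, hl⟩ := (isWGraph_iff.1 hf).2 m
        rcases Finset.mem_insert.1 hw with rfl | hw
        · exact absurd hl hm
        · have h2 := lead_update_of_lead hm hk hl
          have := Lead.unique (hG.1 o (by simp)) (hG.1 w hw) h h2
          exact this ▸ hl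
      · exact lead_update_of_lead hm hk
    simp [hk, this]
  · simp [hk, lead_update_of_not hk]

lemma wt_harmonic {l : ℕ} (q : Fin l → Fin l → ℝ) {o j i : Fin l} (hio : i ≠ o) (hij : i ≠ j) :
    ∑ k, q i k * wt q o j k = (∑ k, q i k) * wt q o j i := by
  rw [Finset.sum_mul]
  simp only [wt_cut q hio hij]
  rw [gSum_sum, gSum_sum]
  refine gSum_congr fun f hf => ?_
  have hex : ∀ k, (1 - if Lead f k i then (1 : ℝ) else 0) * (if Lead f k o then 1 else 0)
      = if Lead f k o then 1 else 0 := by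
    intro k
    by_cases h : Lead f k i
    · have : ¬ Lead f k o := fun h' =>
        hio (Lead.unique (hf.1 i (by simp)) (hf.1 o (by simp)) h h')
      simp [this]
    · simp [h]
  generalize hA : (fun k => if Lead f k i then (1 : ℝ) else 0) = A at *
  generalize hB : (fun k => if Lead f k o then (1 : ℝ) else 0) = B at *
  have hA' : ∀ k, (if Lead f k i then (1 : ℝ) else 0) = A k := fun k => congrFun hA k
  have hB' : ∀ k, (if Lead f k o then (1 : ℝ) else 0) = B k := fun k => congrFun hB k
  have hAi : A i = 1 := by rw [← hA']; simp [Lead.self]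
  simp only [hA', hB', hAi] at hex ⊢
  have hswap : ∑ k, ∑ m, q i k * (q i m * ((1 - A m) * B k))
      = ∑ k, ∑ m, q i k * (q i m * ((1 - A k) * B m)) := by
    rw [Finset.sum_comm]
    exact Finset.sum_congr rfl fun k _ => Finset.sum_congr rfl fun m _ => by ring
  have e1 : ∑ k, q i k * ∑ m, q i m * ((1 - A m) * (A k * B m + (1 - A k) * B k))
      = ∑ k, ∑ m, q i k * (q i m * (A k * B m))
        + ∑ k, ∑ m, q i k * (q i m * ((1 - A m) * B k)) := by
    rw [← Finset.sum_add_distrib]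
    refine Finset.sum_congr rfl fun k _ => ?_
    rw [Finset.mul_sum, ← Finset.sum_add_distrib]
    refine Finset.sum_congr rfl fun m _ => ?_
    linear_combination q i k * q i m * A k * hex m + q i k * q i m * (1 - A m) * hex k
  rw [e1, hswap, ← Finset.sum_add_distrib]
  refine Finset.sum_congr rfl fun k _ => ?_
  rw [Finset.mul_sum, ← Finset.sum_add_distrib]
  refine Finset.sum_congr rfl fun m _ => ?_
  linear_combination - q i k * q i m * hex m

/-- From every set missing `o` the chain can exit. -/
lemma exists_exit {l : ℕ} {p : Fin l → Fin l → ℝ≥0∞} (hirr : Irreducible p) {o : Fin l}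
    (S : Set (Fin l)) (hS : S.Nonempty) (ho : o ∉ S) : ∃ i ∈ S, ∃ k ∉ S, p i k ≠ 0 := by
  by_contra! hcon
  obtain ⟨s, hs⟩ := hS
  have key : ∀ n, ∀ k ∉ S, matPow p n s k = 0 := by
    intro n
    induction n with
    | zero => intro k hk; simp only [matPow]; rw [if_neg]; rintro rfl; exact hk hs
    | succ n ih =>
      intro k hk
      simp only [matPow]
      refine Finset.sum_eq_zero fun t _ => ?_
      by_cases ht : t ∈ S
      · rw [hcon t ht k hk, mul_zero]
      · rw [ih t ht, zero_mul]
  obtain ⟨n, hn⟩ := hirr s o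
  exact hn.ne' (key n o ho)

lemma gSum_pos {l : ℕ} {p : Fin l → Fin l → ℝ≥0∞} (hirr : Irreducible p) {o : Fin l}
    {q : Fin l → Fin l → ℝ} (hq : ∀ i k, 0 ≤ q i k) (hqp : ∀ i k, p i k ≠ 0 → 0 < q i k)
    (W : Finset (Fin l)) (ho : o ∈ W) : 0 < gSum q W (fun _ => 1) := by
  generalize hn : (Wᶜ).card = n
  induction n generalizing W with
  | zero =>
    have : W = Finset.univ := by simpa using hn
    subst this
    have hid : IsWGraph (Finset.univ : Finset (Fin l)) id := by
      simp [IsWGraph]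
    unfold gSum
    refine Finset.sum_pos' (fun _ _ => by simp) ⟨id, by simp [hid], by simp⟩
  | succ n ih =>
    obtain ⟨i, hi, k, hk, hpk⟩ := exists_exit hirr (o := o) {i | i ∉ W}
      (by
        have : (Wᶜ).Nonempty := by rw [← Finset.card_pos]; omega
        obtain ⟨x, hx⟩ := this
        exact ⟨x, by simpa using hx⟩) (by simpa using ho)
    simp only [Set.mem_ofPred_eq, not_not] at hi hk
    rw [gSum_cut q hi]
    have h1 := ih (insert i W) (Finset.mem_insert_of_mem ho) (by
      rw [Finset.compl_insert, Finset.card_erase_of_mem (by simpa using hi)]; omega)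
    have h2 : 0 < q i k * gSum q (insert i W) (fun _ => 1) := mul_pos (hqp i k hpk) h1
    refine lt_of_lt_of_le h2 ?_
    unfold gSum
    rw [Finset.mul_sum]
    refine Finset.sum_le_sum fun f hf => ?_
    have hf := (Finset.mem_filter.1 hf).2
    have hnl : ¬ Lead f k i := fun h => by
      have := Lead.unique (hf.1 k (Finset.mem_insert_of_mem hk)) (hf.1 i (by simp))
        (Lead.self _ _) h
      exact hi (this ▸ hk)
    have : q i k * 1 ≤ ∑ m ∈ Finset.univ.filter (fun m => ¬ Lead f m i), q i m * 1 :=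
      Finset.single_le_sum (f := fun m => q i m * 1) (fun m _ => by simpa using hq i m)
        (by simp [hnl])
    have hp : 0 ≤ ∏ t ∈ (insert i W)ᶜ, q t (f t) := Finset.prod_nonneg fun _ _ => hq _ _
    nlinarith [mul_le_mul_of_nonneg_left this hp]

/-- Minimum principle: comparison of a superharmonic function with the harmonic one. -/
lemma graph_bound {l : ℕ} {p : Fin l → Fin l → ℝ≥0∞} (hirr : Irreducible p) {o j : Fin l}
    (hj : j ≠ o)
    {q : Fin l → Fin l → ℝ} (hq : ∀ i k, 0 ≤ q i k) (hqp : ∀ i k, p i k ≠ 0 → 0 < q i k)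
    (u : Fin l → ℝ) (huo : u o = 1) (huj : u j = 0)
    (hsup : ∀ i, i ≠ o → i ≠ j → ∑ k, q i k * (u k - u i) ≤ 0) :
    gSum q {o} (fun _ => 1) ≤ (∑ k, q j k * u k) * gSum q {o, j} (fun _ => 1) := by
  set G := gSum q {o, j} (fun _ => 1) with hG
  have hG0 : 0 ≤ G := gSum_nonneg hq _ fun _ => zero_le_one
  have key : ∀ k, wt q o j k ≤ u k * G := by
    by_contra! hcon
    obtain ⟨k0, hk0⟩ := hcon
    set D : Fin l → ℝ := fun k => u k * G - wt q o j k with hD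
    obtain ⟨m, -, hm⟩ := Finset.exists_min_image Finset.univ D ⟨k0, Finset.mem_univ _⟩
    have hmneg : D m < 0 := lt_of_le_of_lt (hm k0 (Finset.mem_univ _)) (by simp only [hD]; linarith)
    have hDo : D o = 0 := by simp only [hD]; rw [wt_root, huo, ← hG]; ring
    have hDj : D j = 0 := by simp only [hD]; rw [wt_other q hj, huj]; ring
    obtain ⟨i, hi, k, hk, hpk⟩ := exists_exit hirr (o := o) {k | D k = D m} ⟨m, rfl⟩
      (by simp only [Set.mem_ofPred_eq, hDo]; exact hmneg.ne')
    simp only [Set.mem_ofPred_eq] at hi hk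
    have hio : i ≠ o := by rintro rfl; rw [hDo] at hi; exact hmneg.ne hi.symm
    have hij : i ≠ j := by rintro rfl; rw [hDj] at hi; exact hmneg.ne hi.symm
    have h1 : ∑ k, q i k * (D k - D i) = (∑ k, q i k * (u k - u i)) * G := by
      have h := wt_harmonic q (o := o) (j := j) hio hij
      rw [Finset.sum_mul] at h
      have : ∑ k, q i k * (D k - D i) = (∑ k, q i k * (u k - u i)) * G
        - (∑ k, q i k * wt q o j k - ∑ k, q i k * wt q o j i) := by
        rw [Finset.sum_mul, ← Finset.sum_sub_distrib, ← Finset.sum_sub_distrib]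
        exact Finset.sum_congr rfl fun k _ => by simp only [hD]; ring
      rw [this, h]; ring
    have h2 : 0 < ∑ k, q i k * (D k - D i) := by
      refine Finset.sum_pos' (fun t _ => mul_nonneg (hq i t) ?_) ⟨k, Finset.mem_univ _, ?_⟩
      · rw [hi]; linarith [hm t (Finset.mem_univ _)]
      · refine mul_pos (hqp i k hpk) ?_
        rw [hi]
        exact sub_pos.2 (lt_of_le_of_ne (hm k (Finset.mem_univ _)) (Ne.symm hk))
    have h3 := mul_nonpos_of_nonpos_of_nonneg (hsup i hio hij) hG0
    linarith
  rw [gSum_single q hj, Finset.sum_mul]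
  refine Finset.sum_le_sum fun k _ => ?_
  rw [mul_assoc]
  exact mul_le_mul_of_nonneg_left (key k) (hq j k)

set_option linter.unusedSectionVars false

/-! ### Words and cylinder events -/

/-- words of length at most `N` avoiding `o` and containing `m` visits to `j` -/
def goodWords {l : ℕ} (o j : Fin l) : ℕ → ℕ → List (List (Fin l))
  | _, 0 => [[]]
  | 0, _ + 1 => []
  | N + 1, m + 1 => (List.finRange l).flatMap fun k =>
      if k = o then [] else if k = j then (goodWords o j N m).map (fun w => k :: w)
      else (goodWords o j N (m + 1)).map (fun w => k :: w)

/-- total probability of a list of words -/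
noncomputable def wsum {l : ℕ} (κ : Kernel X X) (Xs : Fin l → Set X) (x : X)
    (L : List (List (Fin l))) : ℝ≥0∞ :=
  (L.map fun w => cylProb κ x (w.map Xs)).sum

/-- boundary values -/
noncomputable def bdry {l : ℕ} (o j : Fin l) (d : Fin l → ℝ≥0∞) (k : Fin l) : ℝ≥0∞ :=
  if k = o then 0 else if k = j then 1 else d k

lemma wsum_cons_le {l : ℕ} (κ : Kernel X X) (Xs : Fin l → Set X)
    (hXmeas : ∀ i, MeasurableSet (Xs i)) (x : X) (k : Fin l)
    (L : List (List (Fin l))) (c : ℝ≥0∞) (h : ∀ y ∈ Xs k, wsum κ Xs y L ≤ c) :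
    wsum κ Xs x (L.map (fun w => k :: w)) ≤ κ x (Xs k) * c := by
  have h1 : wsum κ Xs x (L.map (fun w => k :: w)) ≤ ∫⁻ y in Xs k, wsum κ Xs y L ∂ κ x := by
    clear h
    induction L with
    | nil => simp [wsum]
    | cons w L ih =>
      have e1 : wsum κ Xs x ((w :: L).map (fun w => k :: w))
          = (∫⁻ y in Xs k, cylProb κ y (w.map Xs) ∂ κ x)
            + wsum κ Xs x (L.map (fun w => k :: w)) := by
        simp [wsum, cylProb]
      have e2 : ∀ y, wsum κ Xs y (w :: L) = cylProb κ y (w.map Xs) + wsum κ Xs y L := by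
        intro y; simp [wsum]
      rw [e1]
      simp only [e2]
      exact le_trans (add_le_add le_rfl ih) (le_lintegral_add _ _)
  refine h1.trans ?_
  calc ∫⁻ y in Xs k, wsum κ Xs y L ∂ κ x ≤ ∫⁻ y in Xs k, c ∂ κ x :=
        setLIntegral_mono' (hXmeas k) h
    _ = κ x (Xs k) * c := by rw [setLIntegral_const, mul_comm]

/-- the bound for words with `m` visits -/
noncomputable def psi {l : ℕ} (j : Fin l) (d : Fin l → ℝ≥0∞) : ℕ → Fin l → ℝ≥0∞
  | 0, _ => 1
  | m + 1, i => d j ^ m * d i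

lemma psi_self {l : ℕ} (j : Fin l) (d : Fin l → ℝ≥0∞) (m : ℕ) : psi j d m j = d j ^ m := by
  cases m with
  | zero => simp [psi]
  | succ m => simp [psi, pow_succ]

lemma wsum_flatMap {l : ℕ} (κ : Kernel X X) (Xs : Fin l → Set X) (x : X)
    (F : Fin l → List (List (Fin l))) :
    wsum κ Xs x ((List.finRange l).flatMap F) = ∑ k, wsum κ Xs x (F k) := by
  have : ∀ ks : List (Fin l), wsum κ Xs x (ks.flatMap F)
      = (ks.map fun k => wsum κ Xs x (F k)).sum := by
    intro ks
    induction ks with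
    | nil => simp [wsum]
    | cons k ks ih =>
      rw [List.flatMap_cons, List.map_cons, List.sum_cons, ← ih]
      simp [wsum]
  rw [this, ← List.sum_ofFn, List.ofFn_eq_map]

lemma wsum_good_le {l : ℕ} (κ : Kernel X X) (Xs : Fin l → Set X)
    (hXmeas : ∀ i, MeasurableSet (Xs i)) (o j : Fin l) (hj : j ≠ o) (d : Fin l → ℝ≥0∞)
    (hd : ∀ i, ∀ x ∈ Xs i, ∑ k, κ x (Xs k) * bdry o j d k ≤ d i) (N : ℕ) :
    ∀ m i, ∀ x ∈ Xs i, wsum κ Xs x (goodWords o j N m) ≤ psi j d m i := by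
  induction N with
  | zero =>
    intro m i x _
    cases m with
    | zero => simp [goodWords, wsum, cylProb, psi]
    | succ m => simp [goodWords, wsum]
  | succ N ih =>
    intro m i x hx
    cases m with
    | zero => simp [goodWords, wsum, cylProb, psi]
    | succ m =>
      rw [goodWords, wsum_flatMap]
      calc _ ≤ ∑ k, d j ^ m * (κ x (Xs k) * bdry o j d k) := by
            refine Finset.sum_le_sum fun k _ => ?_
            unfold bdry
            by_cases hko : k = o
            · simp [hko, wsum]
            by_cases hkj : k = j
            · subst hkj
              rw [if_neg hko, if_pos rfl, if_neg hko, if_pos rfl]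
              refine (wsum_cons_le κ Xs hXmeas x k _ _ (ih m k)).trans ?_
              rw [psi_self, mul_one, mul_comm]
            · rw [if_neg hko, if_neg hkj, if_neg hko, if_neg hkj]
              refine (wsum_cons_le κ Xs hXmeas x k _ _ (ih (m + 1) k)).trans ?_
              rw [psi]
              exact le_of_eq (by ring)
        _ = d j ^ m * ∑ k, κ x (Xs k) * bdry o j d k := by rw [Finset.mul_sum]
        _ ≤ psi j d (m + 1) i := by
            rw [psi]; gcongr; exact hd i x hx

/-- the path follows the word -/
def Follows {l : ℕ} (Xs : Fin l → Set X) : (ℕ → X) → List (Fin l) → Prop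
  | _, [] => True
  | ω, k :: w => ω 0 ∈ Xs k ∧ Follows Xs (fun n => ω (n + 1)) w

/-- visit to `j` at time `n`, not having visited `o` so far -/
def Vis {l : ℕ} (Xs : Fin l → Set X) (o j : Fin l) (ω : ℕ → X) (n : ℕ) : Prop :=
  ω n ∈ Xs j ∧ ∀ k ≤ n, ω k ∉ Xs o

lemma vis_succ {l : ℕ} (Xs : Fin l → Set X) (o j : Fin l) (ω : ℕ → X) (n : ℕ) :
    Vis Xs o j ω (n + 1) ↔ ω 0 ∉ Xs o ∧ Vis Xs o j (fun n => ω (n + 1)) n := by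
  unfold Vis
  constructor
  · rintro ⟨h1, h2⟩
    exact ⟨h2 0 (by omega), h1, fun k hk => h2 (k + 1) (by omega)⟩
  · rintro ⟨h0, h1, h2⟩
    refine ⟨h1, fun k hk => ?_⟩
    cases k with
    | zero => exact h0
    | succ k => exact h2 k (by omega)

lemma count_vis_succ {l : ℕ} (Xs : Fin l → Set X) (o j : Fin l) (ω : ℕ → X) (N : ℕ)
    (h0 : ω 0 ∉ Xs o) :
    Nat.count (Vis Xs o j ω) (N + 1) = Nat.count (Vis Xs o j (fun n => ω (n + 1))) N
      + if Vis Xs o j ω 0 then 1 else 0 := by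
  have hs : (fun n => Vis Xs o j ω (n + 1)) = Vis Xs o j (fun n => ω (n + 1)) := by
    funext n; rw [vis_succ]; simp [h0]
  rw [Nat.count_succ']
  congr!

lemma exists_word {l : ℕ} (Xs : Fin l → Set X) (hXcover : (⋃ i, Xs i) = Set.univ)
    (hXdisj : Pairwise fun i j => Disjoint (Xs i) (Xs j)) (o j : Fin l) (N : ℕ) :
    ∀ (m : ℕ) (ω : ℕ → X), m ≤ Nat.count (Vis Xs o j ω) N →
      ∃ w ∈ goodWords o j N m, Follows Xs ω w := by
  induction N with
  | zero =>
    intro m ω h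
    have : m = 0 := by simpa using h
    subst this
    exact ⟨[], by simp [goodWords], trivial⟩
  | succ N ih =>
    intro m ω h
    cases m with
    | zero => exact ⟨[], by simp [goodWords], trivial⟩
    | succ m =>
      have h0 : ω 0 ∉ Xs o := by
        intro hc
        have e0 : ¬ Vis Xs o j ω 0 := fun hv => hv.2 0 le_rfl hc
        have e1 : ∀ n, ¬ Vis Xs o j ω (n + 1) := fun n hv => hv.2 0 (by omega) hc
        rw [Nat.count_succ'] at h
        simp [e0, e1] at h
      rw [count_vis_succ Xs o j ω N h0] at h
      obtain ⟨k, hk⟩ : ∃ k, ω 0 ∈ Xs k := by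
        have : ω 0 ∈ ⋃ i, Xs i := by rw [hXcover]; trivial
        simpa using this
      have hko : k ≠ o := by rintro rfl; exact h0 hk
      by_cases hkj : k = j
      · subst hkj
        obtain ⟨w, hw, hf⟩ := ih m (fun n => ω (n + 1)) (by split_ifs at h <;> omega)
        refine ⟨k :: w, ?_, hk, hf⟩
        rw [goodWords, List.mem_flatMap]
        exact ⟨k, List.mem_finRange k, by simp [hko, hw]⟩
      · have e0 : ¬ Vis Xs o j ω 0 := fun hv =>
          Set.disjoint_left.1 (hXdisj hkj) hk hv.1
        rw [if_neg e0] at h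
        obtain ⟨w, hw, hf⟩ := ih (m + 1) (fun n => ω (n + 1)) (by omega)
        refine ⟨k :: w, ?_, hk, hf⟩
        rw [goodWords, List.mem_flatMap]
        exact ⟨k, List.mem_finRange k, by simp [hko, hkj, hw]⟩

lemma follows_get {l : ℕ} (Xs : Fin l → Set X) (w : List (Fin l)) :
    ∀ ω : ℕ → X, Follows Xs ω w → ∀ k, ω k ∈ (w.map Xs).getD k Set.univ := by
  induction w with
  | nil => intro ω _ k; simp
  | cons a w ih =>
    rintro ω ⟨h0, h1⟩ k
    cases k with
    | zero => simpa using h0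
    | succ k => simpa using ih _ h1 k

lemma measurableSet_getD {l : ℕ} (Xs : Fin l → Set X) (hXmeas : ∀ i, MeasurableSet (Xs i))
    (w : List (Fin l)) : ∀ k, MeasurableSet ((w.map Xs).getD k Set.univ) := by
  induction w with
  | nil => intro k; simp
  | cons a w ih =>
    intro k
    cases k with
    | zero => simpa using hXmeas a
    | succ k => simpa using ih k

lemma range_map_getD {α : Type} (L : List α) (a : α) :
    (List.range L.length).map (fun k => L.getD k a) = L := by
  apply List.ext_getElem
  · simp
  · intro i h1 h2
    simp at h1
    simp [h1]

lemma follows_prob {l : ℕ} {κ : Kernel X X} {Q : X → Measure (ℕ → X)}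
    (hQ : IsMarkovChainLawKernel κ Q) (Xs : Fin l → Set X)
    (hXmeas : ∀ i, MeasurableSet (Xs i)) (x : X) (w : List (Fin l)) :
    Q x {ω | Follows Xs (fun n => ω (n + 1)) w} ≤ cylProb κ x (w.map Xs) := by
  have h := hQ.2 x (w.map Xs).length (fun k => (Set.univ :: w.map Xs).getD k Set.univ)
    (by
      intro k
      cases k with
      | zero => simp
      | succ k => simpa using measurableSet_getD Xs hXmeas w k)
  have e : (List.range (w.map Xs).length).map
      (fun k => (Set.univ :: w.map Xs).getD (k + 1) Set.univ) = w.map Xs := by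
    simpa only [List.getD_cons_succ] using range_map_getD (w.map Xs) Set.univ
  rw [e] at h
  simp only [List.getD_cons_zero, Set.indicator_univ, one_mul] at h
  rw [← h]
  refine measure_mono fun ω hω k _ => ?_
  cases k with
  | zero => simp
  | succ k => simpa only [List.getD_cons_succ] using follows_get Xs w _ hω k

lemma words_prob {l : ℕ} {κ : Kernel X X} {Q : X → Measure (ℕ → X)}
    (hQ : IsMarkovChainLawKernel κ Q) (Xs : Fin l → Set X)
    (hXmeas : ∀ i, MeasurableSet (Xs i)) (x : X) (L : List (List (Fin l))) :
    Q x {ω | ∃ w ∈ L, Follows Xs (fun n => ω (n + 1)) w} ≤ wsum κ Xs x L := by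
  induction L with
  | nil => simp
  | cons w L ih =>
    have : {ω : ℕ → X | ∃ v ∈ w :: L, Follows Xs (fun n => ω (n + 1)) v}
        ⊆ {ω | Follows Xs (fun n => ω (n + 1)) w} ∪
          {ω | ∃ w ∈ L, Follows Xs (fun n => ω (n + 1)) w} := by
      rintro ω ⟨v, hv, hf⟩
      rcases List.mem_cons.1 hv with rfl | hv
      · exact Or.inl hf
      · exact Or.inr ⟨v, hv, hf⟩
    refine (measure_mono this).trans ((measure_union_le _ _).trans ?_)
    have e : wsum κ Xs x (w :: L) = cylProb κ x (w.map Xs) + wsum κ Xs x L := by simp [wsum]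
    rw [e]
    exact add_le_add (follows_prob hQ Xs hXmeas x w) ih

lemma start_null {κ : Kernel X X} {Q : X → Measure (ℕ → X)}
    (hQ : IsMarkovChainLawKernel κ Q) {A : Set X} (hA : MeasurableSet A) {x : X} (hx : x ∈ A) :
    Q x {ω | ω 0 ∉ A} = 0 := by
  have h := hQ.2 x 0 (fun _ => Aᶜ) (fun _ => hA.compl)
  simp only [Set.indicator_of_notMem (show x ∉ Aᶜ from fun h => h hx), zero_mul] at h
  rw [← h]
  congr 1
  ext ω
  simp

lemma vis_of_lt {l : ℕ} {Xs : Fin l → Set X} {o j : Fin l} (hj : j ≠ o) {ω : ℕ → X}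
    (h0 : ω 0 ∈ Xs j) {n : ℕ} (h : (n : ℝ≥0∞) < retMS Xs o ω ∧ ω n ∈ Xs j) :
    Vis Xs o j ω n := by
  refine ⟨h.2, fun k hk hko => ?_⟩
  have hhit : hitS (⋃ (j) (_ : j ≠ o), Xs j) ω ≤ (k : ℝ≥0∞) := by
    unfold hitS
    refine (iInf₂_le 0 ?_).trans (by simp)
    simp only [Set.mem_ofPred_eq, Set.mem_iUnion]
    exact ⟨j, hj, h0⟩
  have : retMS Xs o ω ≤ k := by
    unfold retMS
    exact iInf₂_le k ⟨hhit, hko⟩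
  have h2 : (n : ℝ≥0∞) < k := lt_of_lt_of_le h.1 this
  have h3 : n < k := by exact_mod_cast h2
  omega

lemma exists_count {l : ℕ} {Xs : Fin l → Set X} {o j : Fin l} (hj : j ≠ o) {ω : ℕ → X}
    (h0 : ω 0 ∈ Xs j) {m : ℕ} (h : (m : ℝ≥0∞) + 1 ≤ numVisitsM Xs o j ω) :
    ∃ N, m + 1 ≤ Nat.count (Vis Xs o j ω) N := by
  by_contra! hcon
  have : numVisitsM Xs o j ω ≤ m := by
    unfold numVisitsM
    rw [ENNReal.tsum_eq_iSup_nat]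
    refine iSup_le fun N => ?_
    calc _ ≤ ∑ n ∈ Finset.range N, if Vis Xs o j ω n then (1 : ℝ≥0∞) else 0 := by
          refine Finset.sum_le_sum fun n _ => ?_
          split_ifs with h1 h2
          · exact le_rfl
          · exact absurd (vis_of_lt hj h0 h1) h2
          · exact zero_le
          · exact le_rfl
      _ = (Nat.count (Vis Xs o j ω) N : ℝ≥0∞) := by
          rw [Finset.sum_boole, Nat.count_eq_card_filter_range]
      _ ≤ m := by
          have := hcon N
          exact_mod_cast Nat.lt_succ_iff.1 this
  have h1 := h.trans this
  have h2 : m + 1 ≤ m := by exact_mod_cast h1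
  omega

lemma visits_prob_le {l : ℕ} {κ : Kernel X X} {Q : X → Measure (ℕ → X)}
    (hQ : IsMarkovChainLawKernel κ Q) (Xs : Fin l → Set X)
    (hXmeas : ∀ i, MeasurableSet (Xs i)) (hXcover : (⋃ i, Xs i) = Set.univ)
    (hXdisj : Pairwise fun i j => Disjoint (Xs i) (Xs j)) (o j : Fin l) (hj : j ≠ o)
    (d : Fin l → ℝ≥0∞)
    (hd : ∀ i, ∀ x ∈ Xs i, ∑ k, κ x (Xs k) * bdry o j d k ≤ d i) (m : ℕ) (x : X)
    (hx : x ∈ Xs j) :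
    Q x {ω | ((m : ℝ≥0∞) + 1) ≤ numVisitsM Xs o j ω} ≤ d j ^ m := by
  let E : ℕ → Set (ℕ → X) := fun N => {ω | m ≤ Nat.count (Vis Xs o j (fun n => ω (n + 1))) N}
  have hE : Monotone E := fun N M hNM ω hω => le_trans hω (Nat.count_monotone _ hNM)
  have hsub : {ω | ((m : ℝ≥0∞) + 1) ≤ numVisitsM Xs o j ω} ⊆ {ω | ω 0 ∉ Xs j} ∪ ⋃ N, E N := by
    intro ω hω
    by_cases h0 : ω 0 ∈ Xs j
    · right
      obtain ⟨N, hN⟩ := exists_count hj h0 hω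
      have h0' : ω 0 ∉ Xs o := Set.disjoint_left.1 (hXdisj hj) h0
      refine Set.mem_iUnion.2 ⟨N, ?_⟩
      have h1 := hN.trans (Nat.count_monotone (Vis Xs o j ω) (Nat.le_succ N))
      rw [Nat.succ_eq_add_one, count_vis_succ Xs o j ω N h0'] at h1
      show m ≤ _
      split_ifs at h1 <;> omega
    · exact Or.inl h0
  refine (measure_mono hsub).trans ((measure_union_le _ _).trans ?_)
  rw [start_null hQ (hXmeas j) hx, zero_add, hE.measure_iUnion]
  refine iSup_le fun N => ?_
  rw [← psi_self]
  refine le_trans ?_ (wsum_good_le κ Xs hXmeas o j hj d hd N m j x hx)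
  refine le_trans (measure_mono ?_) (words_prob hQ Xs hXmeas x _)
  intro ω hω
  exact exists_word Xs hXcover hXdisj o j N m _ hω

lemma stay_prob_le {l : ℕ} {κ : Kernel X X} {Q : X → Measure (ℕ → X)}
    (hQ : IsMarkovChainLawKernel κ Q) (Xs : Fin l → Set X)
    (hXmeas : ∀ i, MeasurableSet (Xs i)) (hXcover : (⋃ i, Xs i) = Set.univ)
    (o : Fin l) (r : ℝ≥0∞) (hr : ∀ x ∈ Xs o, κ x (Xs o) ≤ r) (m : ℕ) (x : X)
    (hx : x ∈ Xs o) :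
    Q x {ω | ((m : ℝ≥0∞) + 1) ≤ numVisitsM Xs o o ω} ≤ r ^ m := by
  have hsub : {ω | ((m : ℝ≥0∞) + 1) ≤ numVisitsM Xs o o ω} ⊆ {ω | ∀ k ≤ m, ω k ∈ Xs o} := by
    intro ω hω k hk
    by_contra hko
    have hhit : hitS (⋃ (j) (_ : j ≠ o), Xs j) ω ≤ (k : ℝ≥0∞) := by
      unfold hitS
      refine iInf₂_le k ?_
      have : ω k ∈ ⋃ i, Xs i := by rw [hXcover]; trivial
      obtain ⟨i, hi⟩ := Set.mem_iUnion.1 this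
      simp only [Set.mem_ofPred_eq, Set.mem_iUnion]
      exact ⟨i, by rintro rfl; exact hko hi, hi⟩
    have : numVisitsM Xs o o ω ≤ k := by
      unfold numVisitsM
      rw [tsum_eq_sum (s := Finset.range k)]
      · calc _ ≤ ∑ n ∈ Finset.range k, (1 : ℝ≥0∞) :=
            Finset.sum_le_sum fun n _ => by split_ifs <;> simp
          _ = k := by simp
      · intro n hn
        rw [if_neg]
        rintro ⟨h1, h2⟩
        have hkn : k ≤ n := by simpa using hn
        have : retMS Xs o ω ≤ n := by
          unfold retMS
          exact iInf₂_le n ⟨hhit.trans (by exact_mod_cast hkn), h2⟩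
        exact absurd h1 (not_lt.2 this)
    have h1 : (m : ℝ≥0∞) + 1 ≤ k := le_trans hω this
    have h2 : m + 1 ≤ k := by exact_mod_cast h1
    omega
  refine (measure_mono hsub).trans ?_
  rw [hQ.2 x m (fun _ => Xs o) (fun _ => hXmeas o)]
  simp only [Set.indicator_of_mem hx, one_mul]
  have key : ∀ (L : List ℕ) (x : X), x ∈ Xs o →
      cylProb κ x (L.map fun _ => Xs o) ≤ r ^ L.length := by
    intro L
    induction L with
    | nil => intro x _; simp [cylProb]
    | cons a L ih =>
      intro x hx
      simp only [List.map_cons, cylProb, List.length_cons]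
      calc _ ≤ ∫⁻ y in Xs o, r ^ L.length ∂ κ x := setLIntegral_mono' (hXmeas o) ih
        _ = r ^ L.length * κ x (Xs o) := by rw [setLIntegral_const]
        _ ≤ r ^ L.length * r := by gcongr; exact hr x hx
        _ = _ := (pow_succ _ _).symm
  simpa using key (List.range m) x hx

lemma exists_fix {l : ℕ} (κ : Kernel X X) (hκ : IsMarkovKernel κ) (Xs : Fin l → Set X)
    (hsum : ∀ x, ∑ k, κ x (Xs k) = 1) (o j : Fin l) :
    ∃ d : Fin l → ℝ≥0∞, (∀ i, d i ≤ 1) ∧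
      ∀ i, d i = ⨆ x ∈ Xs i, ∑ k, κ x (Xs k) * bdry o j d k := by
  let Φ : (Fin l → ℝ≥0∞) →o (Fin l → ℝ≥0∞) :=
    { toFun := fun d i => ⨆ x ∈ Xs i, ∑ k, κ x (Xs k) * bdry o j d k
      monotone' := by
        intro d e hde i
        refine iSup₂_mono fun x _ => Finset.sum_le_sum fun k _ => ?_
        gcongr
        unfold bdry
        split_ifs
        · exact le_rfl
        · exact le_rfl
        · exact hde k }
  refine ⟨Φ.lfp, ?_, fun i => congrFun Φ.map_lfp.symm i⟩
  have : Φ.lfp ≤ fun _ => 1 := by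
    refine OrderHom.lfp_le _ fun i => ?_
    refine iSup₂_le fun x _ => ?_
    refine le_trans ?_ (hsum x).le
    refine Finset.sum_le_sum fun k _ => ?_
    have : bdry o j (fun _ => 1) k ≤ 1 := by unfold bdry; split_ifs <;> simp
    calc _ ≤ κ x (Xs k) * 1 := by gcongr
      _ = _ := mul_one _
  exact this

/-! ### Comparison of the two chains -/

lemma toReal_graphSum {l : ℕ} {p : Fin l → Fin l → ℝ≥0∞} (hp : ∀ i k, p i k ≠ ⊤)
    (W : Finset (Fin l)) :
    graphSum p W ≠ ⊤ ∧ (graphSum p W).toReal = gSum (fun i k => (p i k).toReal) W (fun _ => 1) := by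
  have hprod : ∀ g : Fin l → Fin l, ∏ i ∈ Wᶜ, p i (g i) ≠ ⊤ := fun g =>
    ENNReal.prod_ne_top fun i _ => hp i (g i)
  constructor
  · exact ENNReal.sum_ne_top.2 fun g _ => hprod g
  · unfold graphSum gSum
    rw [ENNReal.toReal_sum fun g _ => hprod g]
    simp only [ENNReal.toReal_prod, mul_one]

lemma gSum_mono_scale {l : ℕ} {q q' : Fin l → Fin l → ℝ} (hq : ∀ i k, 0 ≤ q i k) (c : ℝ)
    (h : ∀ i k, q i k ≤ c * q' i k) (W : Finset (Fin l)) :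
    gSum q W (fun _ => 1) ≤ c ^ (Wᶜ).card * gSum q' W (fun _ => 1) := by
  unfold gSum
  rw [Finset.mul_sum]
  refine Finset.sum_le_sum fun g _ => ?_
  rw [mul_one, mul_one, ← Finset.prod_const, ← Finset.prod_mul_distrib]
  exact Finset.prod_le_prod (fun i _ => hq i _) fun i _ => h i _

lemma exponent_le (l : ℕ) (hl : 2 ≤ l) : (l - 1) + (l - 2) ≤ 4 ^ (l - 1) := by
  have h1 : l - 1 < 2 ^ (l - 1) := Nat.lt_two_pow_self
  have h2 : (4 : ℕ) ^ (l - 1) = 2 ^ (l - 1) * 2 ^ (l - 1) := by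
    rw [← mul_pow]; norm_num
  have h3 : 2 ≤ 2 ^ (l - 1) := by
    calc 2 = 2 ^ 1 := rfl
      _ ≤ 2 ^ (l - 1) := Nat.pow_le_pow_right (by norm_num) (by omega)
  have h4 : l - 2 ≤ l - 1 := by omega
  have h5 := Nat.mul_le_mul h3 (le_refl (2 ^ (l - 1)))
  omega

lemma escape_bound {l : ℕ} (hl : 2 ≤ l)
    (p : Fin l → Fin l → ℝ≥0∞) (hrow : ∀ i, ∑ j, p i j = 1)
    (hirr : Irreducible p)
    (Xs : Fin l → Set X)
    (κ : Kernel X X) (hκ : IsMarkovKernel κ) (hsum : ∀ x, ∑ k, κ x (Xs k) = 1)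
    (a : ℝ≥0∞) (ha1 : 1 ≤ a) (haT : a ≠ ⊤)
    (hcomp : ∀ (i j : Fin l), j ≠ i → ∀ x ∈ Xs i,
      a⁻¹ * p i j ≤ κ x (Xs j) ∧ κ x (Xs j) ≤ a * p i j)
    (o : Fin l) (j : Fin l) (hj : j ≠ o) (d : Fin l → ℝ≥0∞) (hd1 : ∀ i, d i ≤ 1)
    (hd : ∀ i, d i = ⨆ x ∈ Xs i, ∑ k, κ x (Xs k) * bdry o j d k) :
    (1 - d j)⁻¹ ≤ a ^ (4 ^ (l - 1)) * (graphSum p {o, j} / graphSum p {o}) := by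
  -- real versions
  have hpT : ∀ i k, p i k ≠ ⊤ := fun i k => by
    have : p i k ≤ 1 := by
      rw [← hrow i]; exact Finset.single_le_sum (f := p i) (fun _ _ => zero_le) (Finset.mem_univ k)
    exact ne_top_of_le_ne_top ENNReal.one_ne_top this
  have hκT : ∀ x k, κ x (Xs k) ≠ ⊤ := fun x k => measure_ne_top _ _
  obtain ⟨α, hα⟩ : ∃ α : ℝ, α = a.toReal := ⟨_, rfl⟩
  have hα1 : 1 ≤ α := by
    rw [hα, ← ENNReal.toReal_one]; exact ENNReal.toReal_mono haT ha1
  have hα0 : 0 < α := by linarith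
  set P : Fin l → Fin l → ℝ := fun i k => (p i k).toReal with hP
  have hP0 : ∀ i k, 0 ≤ P i k := fun i k => ENNReal.toReal_nonneg
  have hProw : ∀ i, ∑ k, P i k = 1 := by
    intro i
    have := congrArg ENNReal.toReal (hrow i)
    rwa [ENNReal.toReal_sum fun k _ => hpT i k, ENNReal.toReal_one] at this
  set K : X → Fin l → ℝ := fun x k => (κ x (Xs k)).toReal with hK
  have hK0 : ∀ x k, 0 ≤ K x k := fun i k => ENNReal.toReal_nonneg
  have hKsum : ∀ x, ∑ k, K x k = 1 := by
    intro x
    have := congrArg ENNReal.toReal (hsum x)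
    rwa [ENNReal.toReal_sum fun k _ => hκT x k, ENNReal.toReal_one] at this
  have hlow : ∀ i k, k ≠ i → ∀ x ∈ Xs i, α⁻¹ * P i k ≤ K x k := by
    intro i k hk x hx
    have := ENNReal.toReal_mono (hκT x k) (hcomp i k hk x hx).1
    rwa [ENNReal.toReal_mul, ENNReal.toReal_inv, ← hα] at this
  have hupp : ∀ i k, k ≠ i → ∀ x ∈ Xs i, K x k ≤ α * P i k := by
    intro i k hk x hx
    have := ENNReal.toReal_mono (ENNReal.mul_ne_top haT (hpT i k)) (hcomp i k hk x hx).2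
    rwa [ENNReal.toReal_mul, ← hα] at this
  have hb1 : ∀ k, bdry o j d k ≤ 1 := fun k => by
    unfold bdry; split_ifs
    · exact zero_le
    · exact le_rfl
    · exact hd1 k
  have hbT : ∀ k, bdry o j d k ≠ ⊤ := fun k => ne_top_of_le_ne_top ENNReal.one_ne_top (hb1 k)
  set u : Fin l → ℝ := fun k => 1 - (bdry o j d k).toReal with hu
  have huo : u o = 1 := by simp [hu, bdry]
  have huj : u j = 0 := by simp [hu, bdry, hj]
  have hu1 : ∀ k, u k ≤ 1 := fun k => by
    simp only [hu]; linarith [ENNReal.toReal_nonneg (a := bdry o j d k)]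
  have hu0 : ∀ k, 0 ≤ u k := fun k => by
    have := ENNReal.toReal_mono ENNReal.one_ne_top (hb1 k)
    rw [ENNReal.toReal_one] at this
    simp only [hu]; linarith
  have hval : ∀ x, ∑ k, κ x (Xs k) * bdry o j d k = ENNReal.ofReal (1 - ∑ k, K x k * u k) := by
    intro x
    have hT : ∀ k ∈ Finset.univ, κ x (Xs k) * bdry o j d k ≠ ⊤ := fun k _ =>
      ENNReal.mul_ne_top (hκT x k) (hbT k)
    rw [← ENNReal.ofReal_toReal (ENNReal.sum_ne_top.2 hT), ENNReal.toReal_sum hT]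
    congr 1
    rw [← hKsum x, ← Finset.sum_sub_distrib]
    refine Finset.sum_congr rfl fun k _ => ?_
    rw [ENNReal.toReal_mul]
    simp only [hu, hK]; ring
  set q : Fin l → Fin l → ℝ := fun i k => if u i < u k then α⁻¹ * P i k else α * P i k with hq
  have hαinv : α⁻¹ ≤ 1 := inv_le_one_of_one_le₀ hα1
  have hαinv0 : 0 < α⁻¹ := inv_pos.2 hα0
  have hq0 : ∀ i k, 0 ≤ q i k := fun i k => by
    simp only [hq]; split_ifs
    · exact mul_nonneg hαinv0.le (hP0 _ _)
    · exact mul_nonneg hα0.le (hP0 _ _)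
  have hqp : ∀ i k, p i k ≠ 0 → 0 < q i k := fun i k h => by
    have : 0 < P i k := ENNReal.toReal_pos h (hpT i k)
    simp only [hq]; split_ifs
    · exact mul_pos hαinv0 this
    · exact mul_pos hα0 this
  have hPp : ∀ i k, p i k ≠ 0 → 0 < P i k := fun i k h => ENNReal.toReal_pos h (hpT i k)
  have hqup : ∀ i k, q i k ≤ α * P i k := fun i k => by
    simp only [hq]; split_ifs
    · exact mul_le_mul_of_nonneg_right (by linarith) (hP0 i k)
    · exact le_rfl
  have hqlo : ∀ i k, P i k ≤ α * q i k := fun i k => by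
    simp only [hq]; split_ifs
    · rw [← mul_assoc, mul_inv_cancel₀ hα0.ne', one_mul]
    · nlinarith [mul_le_mul_of_nonneg_right (show 1 ≤ α * α by nlinarith) (hP0 i k)]
  -- superharmonicity
  have hsup : ∀ i, i ≠ o → i ≠ j → ∑ k, q i k * (u k - u i) ≤ 0 := by
    intro i hio hij
    by_contra! hM
    set M := ∑ k, q i k * (u k - u i) with hMdef
    have hdi : (d i).toReal = 1 - u i := by simp [hu, bdry, hio, hij]
    have hle : d i ≤ ENNReal.ofReal (1 - u i - M) := by
      conv_lhs => rw [hd i]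
      refine iSup₂_le fun x hx => ?_
      rw [hval x]
      refine ENNReal.ofReal_le_ofReal ?_
      have e : ∑ k, K x k * (u k - u i) = ∑ k, K x k * u k - u i := by
        simp only [mul_sub, Finset.sum_sub_distrib]
        rw [← Finset.sum_mul, hKsum x, one_mul]
      have : M ≤ ∑ k, K x k * (u k - u i) := by
        refine Finset.sum_le_sum fun k _ => ?_
        by_cases hki : k = i
        · subst hki; simp
        · simp only [hq]
          split_ifs with h
          · exact mul_le_mul_of_nonneg_right (hlow i k hki x hx) (by linarith)
          · exact mul_le_mul_of_nonpos_right (hupp i k hki x hx) (by linarith)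
      linarith
    have h2 := ENNReal.toReal_mono ENNReal.ofReal_ne_top hle
    rw [hdi, ENNReal.toReal_ofReal'] at h2
    have hui : u i = 1 := by
      rcases le_max_iff.1 h2 with h | h
      · linarith
      · linarith [hu1 i]
    have : M ≤ 0 := by
      refine Finset.sum_nonpos fun k _ => mul_nonpos_of_nonneg_of_nonpos (hq0 i k) ?_
      rw [hui]; linarith [hu1 k]
    linarith
  have hmain := graph_bound hirr hj hq0 hqp u huo huj hsup
  set s := ∑ k, q j k * u k with hs
  have hs0 : 0 ≤ s := Finset.sum_nonneg fun k _ => mul_nonneg (hq0 j k) (hu0 k)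
  have hqj : ∀ k, q j k * u k = α⁻¹ * P j k * u k := by
    intro k
    simp only [hq, huj]
    split_ifs with h
    · rfl
    · have : u k = 0 := le_antisymm (not_lt.1 h) (hu0 k)
      simp [this]
  have hs1 : s ≤ 1 := by
    rw [← hProw j]
    refine Finset.sum_le_sum fun k _ => ?_
    rw [hqj k, mul_assoc]
    have h1 : P j k * u k ≤ P j k := mul_le_of_le_one_right (hP0 j k) (hu1 k)
    have h2 : 0 ≤ P j k * u k := mul_nonneg (hP0 j k) (hu0 k)
    nlinarith
  have hdj : d j ≤ ENNReal.ofReal (1 - s) := by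
    conv_lhs => rw [hd j]
    refine iSup₂_le fun x hx => ?_
    rw [hval x]
    refine ENNReal.ofReal_le_ofReal ?_
    have : s ≤ ∑ k, K x k * u k := by
      refine Finset.sum_le_sum fun k _ => ?_
      by_cases hkj : k = j
      · subst hkj; simp [huj]
      · rw [hqj k]
        exact mul_le_mul_of_nonneg_right (hlow j k hkj x hx) (hu0 k)
    linarith
  have hesc : ENNReal.ofReal s ≤ 1 - d j := by
    calc ENNReal.ofReal s = 1 - ENNReal.ofReal (1 - s) := by
          rw [← ENNReal.ofReal_one, ← ENNReal.ofReal_sub _ (by linarith)]; congr 1; ring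
      _ ≤ 1 - d j := tsub_le_tsub_left hdj 1
  -- comparing graph sums
  obtain ⟨hT1, hG1⟩ := toReal_graphSum hpT {o}
  obtain ⟨hT2, hG2⟩ := toReal_graphSum hpT {o, j}
  have c1 : (({o} : Finset (Fin l))ᶜ).card = l - 1 := by simp [Finset.card_compl]
  have c2 : (({o, j} : Finset (Fin l))ᶜ).card = l - 2 := by
    rw [Finset.card_compl, Finset.card_pair hj.symm, Fintype.card_fin]
  have hg1 := gSum_mono_scale hP0 α hqlo {o}
  have hg2 := gSum_mono_scale hq0 α hqup {o, j}
  rw [c1] at hg1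
  rw [c2] at hg2
  have hpos1 := gSum_pos hirr hP0 hPp {o} (o := o) (by simp)
  have hpos2 := gSum_pos hirr hP0 hPp {o, j} (o := o) (by simp)
  set A := gSum P {o} (fun _ => 1) with hA
  set B := gSum P {o, j} (fun _ => 1) with hB
  have hfin : A ≤ α ^ (4 ^ (l - 1)) * s * B := by
    calc A ≤ α ^ (l - 1) * (s * (α ^ (l - 2) * B)) := by
          refine hg1.trans (mul_le_mul_of_nonneg_left (hmain.trans ?_) (by positivity))
          exact mul_le_mul_of_nonneg_left hg2 hs0
      _ = α ^ ((l - 1) + (l - 2)) * (s * B) := by rw [pow_add]; ring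
      _ ≤ α ^ (4 ^ (l - 1)) * (s * B) :=
          mul_le_mul_of_nonneg_right (pow_le_pow_right₀ hα1 (exponent_le l hl))
            (mul_nonneg hs0 hpos2.le)
      _ = _ := by ring
  have hspos : 0 < s := by
    rcases hs0.lt_or_eq with h | h
    · exact h
    · rw [← h] at hfin; simp at hfin; linarith
  have e1 : graphSum p {o} = ENNReal.ofReal A := by
    rw [← hG1, ENNReal.ofReal_toReal hT1]
  have e2 : graphSum p {o, j} = ENNReal.ofReal B := by
    rw [← hG2, ENNReal.ofReal_toReal hT2]
  have e3 : a = ENNReal.ofReal α := by rw [hα, ENNReal.ofReal_toReal haT]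
  calc (1 - d j)⁻¹ ≤ (ENNReal.ofReal s)⁻¹ := ENNReal.inv_le_inv.2 hesc
    _ = ENNReal.ofReal s⁻¹ := (ENNReal.ofReal_inv_of_pos hspos).symm
    _ ≤ ENNReal.ofReal (α ^ (4 ^ (l - 1)) * (B / A)) := by
        refine ENNReal.ofReal_le_ofReal ?_
        rw [inv_le_iff_one_le_mul₀ hspos, ← mul_div_assoc, div_mul_eq_mul_div, le_div_iff₀ hpos1]
        linarith
    _ = _ := by
        rw [e1, e2, e3, ENNReal.ofReal_mul (by positivity), ENNReal.ofReal_pow hα0.le,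
          ENNReal.ofReal_div_of_pos hpos1]

/-- For every `j ≠ 1` (the distinguished index `1` being denoted `o`):
`Σ_{ℓ=1}^{∞} sup_{x∈𝒳_j} P_x(Ñ_j ≥ ℓ) ≤ a^{4^{l−1}} · (Σ_{g∈G(1,j)} π(g) / Σ_{g∈G(1)} π(g))`;
moreover `Σ_{ℓ=1}^{∞} sup_{x∈𝒳_1} P_x(Ñ_1 ≥ ℓ) ≤ a / Σ_{m∈L∖{1}} p_{1m}`. -/
theorem sum_sup_tail_prob_visits_le {l : ℕ} (hl : 2 ≤ l)
    (p : Fin l → Fin l → ℝ≥0∞) (hrow : ∀ i, ∑ j, p i j = 1)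
    (hirr : Irreducible p)
    (Xs : Fin l → Set X) (hXmeas : ∀ i, MeasurableSet (Xs i))
    (hXdisj : Pairwise fun i j => Disjoint (Xs i) (Xs j))
    (hXcover : (⋃ i, Xs i) = Set.univ)
    (κ : Kernel X X) (hκ : IsMarkovKernel κ)
    (Q : X → Measure (ℕ → X)) (hQ : IsMarkovChainLawKernel κ Q)
    (a : ℝ≥0∞) (ha1 : 1 ≤ a) (haT : a ≠ ⊤)
    (hcomp : ∀ (i j : Fin l), j ≠ i → ∀ x ∈ Xs i,
      a⁻¹ * p i j ≤ κ x (Xs j) ∧ κ x (Xs j) ≤ a * p i j)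
    (o : Fin l) (j : Fin l) (hj : j ≠ o) :
    (∑' ℓ : ℕ, ⨆ x ∈ Xs j, Q x {ω | ((ℓ : ℝ≥0∞) + 1) ≤ numVisitsM Xs o j ω})
        ≤ a ^ (4 ^ (l - 1)) * (graphSum p {o, j} / graphSum p {o}) ∧
      (∑' ℓ : ℕ, ⨆ x ∈ Xs o, Q x {ω | ((ℓ : ℝ≥0∞) + 1) ≤ numVisitsM Xs o o ω})
        ≤ a / ∑ m ∈ ({o}ᶜ : Finset (Fin l)), p o m := by
  have hsum : ∀ x, ∑ k, κ x (Xs k) = 1 := by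
    intro x
    have h := measure_iUnion (μ := κ x) hXdisj hXmeas
    rw [hXcover, measure_univ, tsum_fintype] at h
    exact h.symm
  constructor
  · obtain ⟨d, hd1, hd⟩ := exists_fix κ hκ Xs hsum o j
    have hd' : ∀ i, ∀ x ∈ Xs i, ∑ k, κ x (Xs k) * bdry o j d k ≤ d i := by
      intro i x hx
      conv_rhs => rw [hd i]
      exact le_iSup₂ (f := fun x (_ : x ∈ Xs i) => ∑ k, κ x (Xs k) * bdry o j d k) x hx
    calc _ ≤ ∑' m : ℕ, d j ^ m := by
          refine ENNReal.tsum_le_tsum fun m => iSup₂_le fun x hx => ?_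
          exact visits_prob_le hQ Xs hXmeas hXcover hXdisj o j hj d hd' m x hx
      _ = (1 - d j)⁻¹ := ENNReal.tsum_geometric _
      _ ≤ _ := escape_bound hl p hrow hirr Xs κ hκ hsum a ha1 haT hcomp o j hj d hd1 hd
  · set S := ∑ m ∈ ({o}ᶜ : Finset (Fin l)), p o m with hS
    have hS1 : S ≤ 1 := by
      rw [← hrow o]
      exact Finset.sum_le_sum_of_subset (Finset.subset_univ _)
    have hle1 : a⁻¹ * S ≤ 1 := by
      calc a⁻¹ * S ≤ 1 * 1 := mul_le_mul' (ENNReal.inv_le_one.2 ha1) hS1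
        _ = 1 := one_mul 1
    have hr : ∀ x ∈ Xs o, κ x (Xs o) ≤ 1 - a⁻¹ * S := by
      intro x hx
      refine ENNReal.le_sub_of_add_le_right (ne_top_of_le_ne_top ENNReal.one_ne_top hle1) ?_
      rw [← hsum x, ← Finset.sum_add_sum_compl {o} (fun k => κ x (Xs k)), Finset.sum_singleton]
      refine add_le_add le_rfl ?_
      rw [hS, Finset.mul_sum]
      exact Finset.sum_le_sum fun k hk => (hcomp o k (by simpa using hk) x hx).1
    calc _ ≤ ∑' m : ℕ, (1 - a⁻¹ * S) ^ m := by
          refine ENNReal.tsum_le_tsum fun m => iSup₂_le fun x hx => ?_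
          exact stay_prob_le hQ Xs hXmeas hXcover o _ hr m x hx
      _ = (1 - (1 - a⁻¹ * S))⁻¹ := ENNReal.tsum_geometric _
      _ = (a⁻¹ * S)⁻¹ := by
          rw [ENNReal.sub_sub_cancel ENNReal.one_ne_top hle1]
      _ = a / S := by
          have ha0 : a ≠ 0 := (lt_of_lt_of_le one_pos ha1).ne'
          rw [ENNReal.mul_inv (Or.inl (ENNReal.inv_ne_zero.2 haT))
            (Or.inl (ENNReal.inv_ne_top.2 ha0)), inv_inv, div_eq_mul_inv]

end FW
end
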